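/- arXiv:0911.4823 — 4 statements merged into one kernel-verified Lean document; each statement's English description precedes it below -/
import Mathlib

section
/- Let X be a finite list of vectors in ℤ^n whose ℝ-linear span is all of ℝ^n. Then the ℂ-vector space DM(X) of functions f : ℤ^n → ℂ satisfying ∇_A f = 0 for every sublist A ⊆ X with r(X ∖ A) < n is finite-dimensional, and its dimension equals the Lebesgue volume of the zonotope Z(X). -/
open MeasureTheory

/-- The iterated difference operator `∇_A = Π_{λ∈A} ∇_λ` associated to the sublist `A` of the
list `X`, where `(∇_λ f)(x) = f(x) − f(x−λ)`.  It is given by the inclusion-exclusion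
expansion `(∇_A f)(x) = Σ_{S ⊆ A} (−1)^{|S|} f(x − Σ_{λ∈S} λ)`. -/
noncomputable def nabla {n N : ℕ} (X : Fin N → Fin n → ℤ) (A : Finset (Fin N))
    (f : (Fin n → ℤ) → ℂ) : (Fin n → ℤ) → ℂ :=
  fun x => ∑ S ∈ A.powerset, (-1 : ℂ) ^ S.card * f (x - ∑ i ∈ S, X i)

/-- The discrete Dahmen–Micchelli space
`DM(X) = {f : ℤ^n → ℂ | ∇_A f = 0 for all sublists A of X with r(X ∖ A) < n}`. -/
noncomputable def DMspace {n N : ℕ} (X : Fin N → Fin n → ℤ) :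
    Submodule ℂ ((Fin n → ℤ) → ℂ) where
  carrier := {f | ∀ A : Finset (Fin N),
    Module.finrank ℝ (Submodule.span ℝ
      ((fun i (j : Fin n) => (X i j : ℝ)) '' ↑(Finset.univ \ A))) < n →
    nabla X A f = 0}
  add_mem' := by
    intro f g hf hg A hA
    have h1 := hf A hA
    have h2 := hg A hA
    funext x
    have e1 : nabla X A f x = 0 := by rw [h1]; rfl
    have e2 : nabla X A g x = 0 := by rw [h2]; rfl
    simp only [nabla, Pi.add_apply, mul_add, Finset.sum_add_distrib] at *
    simp [nabla] at e1 e2 ⊢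
    rw [e1, e2]
    simp
  zero_mem' := by
    intro A _
    funext x
    simp [nabla]
  smul_mem' := by
    intro c f hf A hA
    have h1 := hf A hA
    funext x
    have e1 : nabla X A f x = 0 := by rw [h1]; rfl
    simp only [nabla, Pi.smul_apply, smul_eq_mul] at *
    rw [Finset.sum_congr rfl (fun S _ => by ring_nf :
      ∀ S ∈ A.powerset, (-1 : ℂ) ^ S.card * (c * f (x - ∑ i ∈ S, X i)) =
        c * ((-1 : ℂ) ^ S.card * f (x - ∑ i ∈ S, X i)))]
    rw [← Finset.mul_sum, e1, mul_zero]
    rfl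

/-- The zonotope generated by a list of real vectors. -/
def zonotope {n : ℕ} {ι : Type} [Fintype ι] (v : ι → Fin n → ℝ) : Set (Fin n → ℝ) :=
  {z | ∃ t : ι → ℝ, (∀ i, t i ∈ Set.Icc (0 : ℝ) 1) ∧ z = ∑ i, t i • v i}

/-- The inclusion of the lattice `ℤ^n` in `ℝ^n`. -/
def castVec (n : ℕ) : (Fin n → ℤ) →+ (Fin n → ℝ) := (Int.castAddHom ℝ).compLeft (Fin n)

lemma castVec_injective (n : ℕ) : Function.Injective (castVec n) := fun x y h => by
  funext j
  have := congrFun h j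
  simpa [castVec] using this

/-- The operator `∏_{i ∈ A} (1 - t_i τ_i)`, where `τ_i` is the translation by `X i`. -/
def twistedNabla {n N : ℕ} {R M : Type*} [CommRing R] [AddCommGroup M] [Module R M]
    (t : Fin N → R) (X : Fin N → Fin n → ℤ) (A : Finset (Fin N))
    (F : (Fin n → ℤ) → M) : (Fin n → ℤ) → M :=
  fun x => ∑ S ∈ A.powerset, ((-1) ^ S.card * ∏ i ∈ S, t i) • F (x - ∑ i ∈ S, X i)

/-- The sublist of `X` indexed by `B` spans `ℝ^n`. -/
def Spans {n N : ℕ} (X : Fin N → Fin n → ℤ) (B : Finset (Fin N)) : Prop :=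
  Submodule.span ℝ ((fun i => castVec n (X i)) '' B) = ⊤

/-- The zonotope of the sublist of `X` indexed by `B`. -/
def subZonotope {n N : ℕ} (X : Fin N → Fin n → ℤ) (B : Finset (Fin N)) : Set (Fin n → ℝ) :=
  {z | ∃ t : Fin N → ℝ, (∀ i, t i ∈ Set.Icc (0 : ℝ) 1) ∧ (∀ i ∉ B, t i = 0) ∧
    z = ∑ i, t i • castVec n (X i)}

section Injectivity

variable {n N : ℕ} {R M : Type*} [CommRing R] [AddCommGroup M] [Module R M]

lemma twistedNabla_empty (t : Fin N → R) (X : Fin N → Fin n → ℤ) (F : (Fin n → ℤ) → M) :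
    twistedNabla t X ∅ F = F := by
  funext x
  simp [twistedNabla]

lemma twistedNabla_zero (t : Fin N → R) (X : Fin N → Fin n → ℤ) (A : Finset (Fin N)) :
    twistedNabla t X A (0 : (Fin n → ℤ) → M) = 0 := by
  funext x
  simp [twistedNabla]

lemma twistedNabla_comp_linearMap {M' : Type*} [AddCommGroup M'] [Module R M'] (t : Fin N → R)
    (X : Fin N → Fin n → ℤ) (A : Finset (Fin N)) (l : M →ₗ[R] M') (F : (Fin n → ℤ) → M)
    (x : Fin n → ℤ) : twistedNabla t X A (fun x => l (F x)) x = l (twistedNabla t X A F x) := by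
  simp [twistedNabla]

lemma twistedNabla_insert (t : Fin N → R) (X : Fin N → Fin n → ℤ) {A : Finset (Fin N)}
    {i : Fin N} (hi : i ∉ A) (F : (Fin n → ℤ) → M) :
    twistedNabla t X (insert i A) F =
      twistedNabla t X A (fun x => F x - t i • F (x - X i)) := by
  funext x
  simp only [twistedNabla, smul_sub, Finset.sum_sub_distrib]
  rw [Finset.sum_powerset_insert hi, sub_eq_add_neg, ← Finset.sum_neg_distrib]
  congr 1
  refine Finset.sum_congr rfl fun S hS => ?_
  have hiS : i ∉ S := fun h => hi (Finset.mem_powerset.1 hS h)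
  rw [Finset.card_insert_of_notMem hiS, Finset.prod_insert hiS, Finset.sum_insert hiS, smul_smul,
    ← neg_smul]
  congr 1
  · ring
  · congr 1
    abel

lemma twistedNabla_eq_zero_of_mem (t : Fin N → R) (X : Fin N → Fin n → ℤ)
    {A : Finset (Fin N)} {i : Fin N} (hi : i ∈ A) {F : (Fin n → ℤ) → M}
    (hF : ∀ x, F x = t i • F (x - X i)) : twistedNabla t X A F = 0 := by
  rw [← Finset.insert_erase hi, twistedNabla_insert t X (Finset.notMem_erase i A)]
  have : (fun x => F x - t i • F (x - X i)) = 0 := by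
    funext x
    simp [← hF x]
  rw [this, twistedNabla_zero]

lemma exists_sum_eq_of_mem_span_image {ι S V : Type*} [Ring S] [AddCommGroup V] [Module S V]
    {v : ι → V} {B : Finset ι} {z : V} (hz : z ∈ Submodule.span S (v '' B)) :
    ∃ r : ι → S, ∑ i ∈ B, r i • v i = z := by
  classical
  obtain ⟨r, hr⟩ := (Submodule.mem_span_image_finset_iff_exists_fun S).1 hz
  refine ⟨fun i => if h : i ∈ B then r ⟨i, h⟩ else 0, ?_⟩
  rw [← hr, ← Finset.sum_coe_sort]
  simp

/-- Every point is congruent modulo the lattice spanned by a spanning list to a point of the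
zonotope. -/
lemma exists_int_sub_mem_subZonotope {X : Fin N → Fin n → ℤ} {B : Finset (Fin N)}
    (hB : Spans X B) (z : Fin n → ℝ) :
    ∃ m : Fin N → ℤ, z - castVec n (∑ i ∈ B, m i • X i) ∈ subZonotope X B := by
  have hz : z ∈ Submodule.span ℝ ((fun i => castVec n (X i)) '' (B : Set (Fin N))) := by
    rw [hB]; trivial
  obtain ⟨r, hr⟩ := exists_sum_eq_of_mem_span_image hz
  refine ⟨fun i => ⌊r i⌋, fun i => if i ∈ B then Int.fract (r i) else 0, fun i => ?_,
    fun i hi => by simp [hi], ?_⟩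
  · dsimp only
    split_ifs
    · exact ⟨Int.fract_nonneg _, (Int.fract_lt_one _).le⟩
    · simp
  · rw [← hr]
    simp only [ite_smul, zero_smul, Finset.sum_ite_mem, Finset.univ_inter, map_sum, map_zsmul]
    rw [← Finset.sum_sub_distrib]
    refine Finset.sum_congr rfl fun i _ => ?_
    rw [Int.fract, sub_smul, Int.cast_smul_eq_zsmul]

lemma subZonotope_mono {X : Fin N → Fin n → ℤ} {B C : Finset (Fin N)} (h : B ⊆ C) :
    subZonotope X B ⊆ subZonotope X C := by
  rintro z ⟨t, h1, h2, h3⟩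
  exact ⟨t, h1, fun i hi => h2 i fun hB => hi (h hB), h3⟩

lemma add_mem_subZonotope {X : Fin N → Fin n → ℤ} {B : Finset (Fin N)} {i : Fin N}
    (hi : i ∈ B) {z : Fin n → ℝ} (hz : z ∈ subZonotope X (B.erase i)) :
    z + castVec n (X i) ∈ subZonotope X B := by
  obtain ⟨t, h1, h2, h3⟩ := hz
  refine ⟨Function.update t i 1, fun j => ?_, fun j hj => ?_, ?_⟩
  · by_cases h : j = i
    · subst h; simp
    · simpa [h] using h1 j
  · have : j ≠ i := fun h => hj (h ▸ hi)
    rw [Function.update_of_ne this]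
    exact h2 j fun h => hj (Finset.mem_of_mem_erase h)
  · have h0 : t i = 0 := h2 i (Finset.notMem_erase i B)
    rw [h3, ← Finset.add_sum_erase _ _ (Finset.mem_univ i),
      ← Finset.add_sum_erase _ (fun j => Function.update t i 1 j • castVec n (X j))
        (Finset.mem_univ i), h0]
    simp only [zero_smul, zero_add, Function.update_self, one_smul]
    rw [add_comm]
    congr 1
    refine Finset.sum_congr rfl fun j hj => ?_
    rw [Function.update_of_ne (Finset.ne_of_mem_erase hj)]

/-- A function killed by all twisted operators attached to the complements of non-spanning
sublists vanishes as soon as it vanishes on the lattice points of a translate of the zonotope. -/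
theorem eq_zero_of_vanishes_on_subZonotope (t : Fin N → R) (ht : ∀ i, IsUnit (t i))
    (X : Fin N → Fin n → ℤ) (B : Finset (Fin N)) :
    ∀ (v : Fin n → ℝ) (F : (Fin n → ℤ) → M),
      (∀ A ⊆ B, ¬ Spans X (B \ A) → twistedNabla t X A F = 0) →
      (∀ x, castVec n x + v ∈ subZonotope X B → F x = 0) → F = 0 := by
  induction B using Finset.strongInduction with
  | H B ih =>
    intro v F hF hv
    by_cases hB : Spans X B
    swap
    · simpa [twistedNabla_empty] using hF ∅ (by simp) (by simpa using hB)
    have key : ∀ i ∈ B, ∀ x, F x = t i • F (x - X i) := by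
      intro i hi x
      have := ih (B.erase i) (Finset.erase_ssubset hi) (v - castVec n (X i))
        (fun x => F x - t i • F (x - X i)) (fun A hA hs => ?_) (fun x hx => ?_)
      · exact sub_eq_zero.1 (congrFun this x)
      · have hiA : i ∉ A := fun h => Finset.notMem_erase i B (hA h)
        rw [← twistedNabla_insert t X hiA]
        refine hF _ (Finset.insert_subset hi (hA.trans (Finset.erase_subset _ _))) ?_
        have : B \ insert i A = B.erase i \ A := by ext; simp; tauto
        rwa [this]
      · have h1 : F x = 0 := hv x (by
          have := add_mem_subZonotope hi hx
          rwa [show castVec n x + (v - castVec n (X i)) + castVec n (X i) = castVec n x + v by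
            abel] at this)
        have h2 : F (x - X i) = 0 := hv _ (by
          have := subZonotope_mono (Finset.erase_subset i B) hx
          rwa [map_sub, show castVec n x - castVec n (X i) + v
            = castVec n x + (v - castVec n (X i)) by abel])
        simp [h1, h2]
    let G : AddSubgroup (Fin n → ℤ) :=
      { carrier := {y | ∀ x, F x = 0 ↔ F (x - y) = 0}
        zero_mem' := by simp
        add_mem' := by
          intro a b ha hb x
          rw [ha x, hb (x - a), sub_sub]
        neg_mem' := by
          intro a ha x
          rw [ha (x - -a)]
          simp }
    have hG : ∀ i ∈ B, X i ∈ G := fun i hi x => by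
      rw [key i hi x]
      exact (ht i).smul_eq_zero
    funext x
    obtain ⟨m, hm⟩ := exists_int_sub_mem_subZonotope hB (castVec n x + v)
    have hmem : ∑ i ∈ B, m i • X i ∈ G := sum_mem fun i hi => zsmul_mem (hG i hi) _
    refine (hmem x).2 (hv _ ?_)
    rwa [map_sub, sub_add_eq_add_sub]

end Injectivity

section OptimalBasis

variable {n N : ℕ}

lemma exists_linearIndependent_int_real (N : ℕ) : ∃ c : Fin N → ℝ, LinearIndependent ℤ c := by
  have h : (N : Cardinal) ≤ Module.rank ℚ ℝ := by
    rw [Real.rank_rat_real]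
    exact (Cardinal.natCast_lt_aleph0.trans_le Cardinal.aleph0_le_continuum).le
  obtain ⟨c, hc⟩ := Module.le_rank_iff.1 h
  exact ⟨c, (LinearIndependent.iff_fractionRing ℤ ℚ).2 hc⟩

lemma linearIndepOn_castVec_iff (X : Fin N → Fin n → ℤ) (B : Set (Fin N)) :
    LinearIndepOn ℝ (fun i => castVec n (X i)) B ↔ LinearIndepOn ℤ X B :=
  linearIndependent_algebraMap_comp_iff (R := ℤ) (S := ℝ) (v := fun i : B => X i)

/-- A linear functional which agrees with integrally independent costs on a spanning
sublist differs from them at the other vectors. -/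
lemma apply_castVec_ne_of_notMem {X : Fin N → Fin n → ℤ} {c : Fin N → ℝ}
    (hc : LinearIndependent ℤ c) {b : Finset (Fin N)} (hs : Spans X b)
    (y : (Fin n → ℝ) →ₗ[ℝ] ℝ) (hy : ∀ i ∈ b, y (castVec n (X i)) = c i) {j : Fin N}
    (hj : j ∉ b) : y (castVec n (X j)) ≠ c j := by
  intro h
  have hdep : ¬ LinearIndepOn ℝ (fun i => castVec n (X i)) (insert j b : Finset (Fin N)) := by
    intro hli
    rw [Finset.coe_insert, linearIndepOn_insert (by simpa using hj)] at hli
    exact hli.2 (by rw [hs]; trivial)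
  rw [linearIndepOn_castVec_iff, linearIndepOn_finset_iff] at hdep
  push Not at hdep
  obtain ⟨g, hg, i, hi, hgi⟩ := hdep
  have hyc : ∀ k ∈ insert j b, y (castVec n (X k)) = c k := by
    intro k hk
    rcases Finset.mem_insert.1 hk with rfl | hk
    · exact h
    · exact hy k hk
  have h0 : ∑ k ∈ insert j b, g k • c k = 0 := by
    have := congrArg (fun x => y (castVec n x)) hg
    simp only [map_sum, map_zsmul, map_zero] at this
    rw [← this]
    exact Finset.sum_congr rfl fun k hk => by rw [hyc k hk]
  exact hgi (linearIndependent_iff'.1 hc _ g h0 i hi)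

/-- `b` is the optimal basis, with dual potential `y` and coefficients `t`, of the problem of
writing `z` as a combination of the vectors of `X` with coefficients in `[0, 1]` at the least
cost, where the `i`-th vector has unit cost `c i`. -/
structure IsOptimalBasis (X : Fin N → Fin n → ℤ) (c : Fin N → ℝ) (z : Fin n → ℝ)
    (b : Finset (Fin N)) (y : (Fin n → ℝ) →ₗ[ℝ] ℝ) (t : Fin N → ℝ) : Prop where
  mem_Icc : ∀ i, t i ∈ Set.Icc (0 : ℝ) 1
  sum_eq : ∑ i, t i • castVec n (X i) = z
  spans : Spans X b
  linearIndepOn : LinearIndepOn ℝ (fun i => castVec n (X i)) (b : Set (Fin N))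
  apply_eq : ∀ i ∈ b, y (castVec n (X i)) = c i
  mem_Ioo : ∀ i ∈ b, t i ∈ Set.Ioo (0 : ℝ) 1
  complementary : ∀ j ∉ b,
    (t j = 0 ∧ y (castVec n (X j)) < c j) ∨ (t j = 1 ∧ c j < y (castVec n (X j)))

lemma IsOptimalBasis.lt_or_eq {X : Fin N → Fin n → ℤ} {c : Fin N → ℝ} {z z' : Fin n → ℝ}
    {b : Finset (Fin N)} {y : (Fin n → ℝ) →ₗ[ℝ] ℝ} {t t' : Fin N → ℝ}
    (h : IsOptimalBasis X c z b y t) (ht' : ∀ i, t' i ∈ Set.Icc (0 : ℝ) 1)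
    (hz' : ∑ i, t' i • castVec n (X i) = z') (m : Fin N → ℤ)
    (hm : z' - z = castVec n (∑ i ∈ b, m i • X i)) :
    y (z' - z) + ∑ i, c i * t i < ∑ i, c i * t' i ∨ z' = z := by
  have hle : ∀ j ∈ Finset.univ, (c j - y (castVec n (X j))) * t j ≤
      (c j - y (castVec n (X j))) * t' j := by
    intro j _
    by_cases hj : j ∈ b
    · simp [h.apply_eq j hj]
    · obtain ⟨h0, h1⟩ := ht' j
      rcases h.complementary j hj with ⟨e, hlt⟩ | ⟨e, hlt⟩ <;> rw [e] <;> nlinarith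
  have hy : ∀ (s : Fin N → ℝ) (w : Fin n → ℝ), ∑ i, s i • castVec n (X i) = w →
      ∑ j, (c j - y (castVec n (X j))) * s j = ∑ j, c j * s j - y w := by
    rintro s w rfl
    simp only [map_sum, map_smul, smul_eq_mul]
    rw [← Finset.sum_sub_distrib]
    exact Finset.sum_congr rfl fun j _ => by ring
  by_cases heq : ∀ j ∈ Finset.univ, (c j - y (castVec n (X j))) * t j =
      (c j - y (castVec n (X j))) * t' j
  · right
    have hoff : ∀ j ∉ b, t' j = t j := by
      intro j hj
      have hne : c j - y (castVec n (X j)) ≠ 0 := by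
        rcases h.complementary j hj with ⟨_, hlt⟩ | ⟨_, hlt⟩
        · exact (sub_pos.2 hlt).ne'
        · exact (sub_neg.2 hlt).ne
      exact (mul_left_cancel₀ hne (heq j (Finset.mem_univ j))).symm
    have hdiff : z' - z = ∑ i ∈ b, (t' i - t i) • castVec n (X i) := by
      rw [← hz', ← h.sum_eq, ← Finset.sum_sub_distrib]
      symm
      rw [Finset.sum_subset (Finset.subset_univ b)]
      · exact Finset.sum_congr rfl fun i _ => sub_smul _ _ _
      · intro i _ hi
        rw [hoff i hi, sub_self, zero_smul]
    have hzero : ∑ i ∈ b, (t' i - t i - m i) • castVec n (X i) = 0 := by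
      have : ∑ i ∈ b, (m i : ℝ) • castVec n (X i) = z' - z := by
        rw [hm, map_sum]
        exact Finset.sum_congr rfl fun i _ => by rw [map_zsmul, Int.cast_smul_eq_zsmul]
      simp only [sub_smul (_ - _), Finset.sum_sub_distrib]
      rw [← hdiff, this, sub_self]
    have hmi := linearIndepOn_finset_iff.1 h.linearIndepOn _ hzero
    rw [← sub_eq_zero, hm]
    have : ∑ i ∈ b, m i • X i = 0 := by
      refine Finset.sum_eq_zero fun i hi => ?_
      have h1 := hmi i hi
      obtain ⟨h2, h3⟩ := h.mem_Ioo i hi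
      obtain ⟨h4, h5⟩ := ht' i
      have h6 : ((-1 : ℤ) : ℝ) < m i := by push_cast; linarith
      have h7 : (m i : ℝ) < (1 : ℤ) := by push_cast; linarith
      rw [Int.cast_lt] at h6 h7
      rw [show m i = 0 by omega, zero_smul]
    rw [this, map_zero]
  · left
    push Not at heq
    obtain ⟨j, hj, hne⟩ := heq
    have hlt := Finset.sum_lt_sum hle ⟨j, hj, lt_of_le_of_ne (hle j hj) hne⟩
    rw [hy t z h.sum_eq, hy t' z' hz'] at hlt
    rw [map_sub]
    linarith

/-- The first order optimality condition. -/
lemma sum_nonneg_of_isMinOn {X : Fin N → Fin n → ℤ} {c t : Fin N → ℝ}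
    (ht : ∀ i, t i ∈ Set.Icc (0 : ℝ) 1)
    (hmin : ∀ t' : Fin N → ℝ, (∀ i, t' i ∈ Set.Icc (0 : ℝ) 1) →
      ∑ i, t' i • castVec n (X i) = ∑ i, t i • castVec n (X i) →
      ∑ i, c i * t i ≤ ∑ i, c i * t' i)
    {r : Fin N → ℝ} (hr : ∑ i, r i • castVec n (X i) = 0) (h0 : ∀ i, t i = 0 → 0 ≤ r i)
    (h1 : ∀ i, t i = 1 → r i ≤ 0) : 0 ≤ ∑ i, c i * r i := by
  have hev : ∀ᶠ ε in nhdsWithin (0 : ℝ) (Set.Ioi 0), ∀ i, t i + ε * r i ∈ Set.Icc (0 : ℝ) 1 := by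
    rw [Filter.eventually_all]
    intro i
    have hcont : Filter.Tendsto (fun ε => t i + ε * r i) (nhdsWithin (0 : ℝ) (Set.Ioi 0))
        (nhds (t i)) := by
      have : Continuous fun ε : ℝ => t i + ε * r i := by fun_prop
      simpa using (this.tendsto 0).mono_left nhdsWithin_le_nhds
    have hpos : ∀ᶠ ε in nhdsWithin (0 : ℝ) (Set.Ioi 0), 0 < ε :=
      eventually_mem_nhdsWithin
    have hl : ∀ᶠ ε in nhdsWithin (0 : ℝ) (Set.Ioi 0), 0 ≤ t i + ε * r i := by
      rcases (ht i).1.eq_or_lt with h | h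
      · filter_upwards [hpos] with ε hε
        rw [← h]
        nlinarith [h0 i h.symm, mul_nonneg hε.le (h0 i h.symm)]
      · filter_upwards [hcont.eventually (lt_mem_nhds h)] with ε hε using hε.le
    have hu : ∀ᶠ ε in nhdsWithin (0 : ℝ) (Set.Ioi 0), t i + ε * r i ≤ 1 := by
      rcases (ht i).2.eq_or_lt with h | h
      · filter_upwards [hpos] with ε hε
        rw [h]
        nlinarith [h1 i h, mul_nonneg hε.le (neg_nonneg.2 (h1 i h))]
      · filter_upwards [hcont.eventually (gt_mem_nhds h)] with ε hε using hε.le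
    filter_upwards [hl, hu] with ε h h' using ⟨h, h'⟩
  obtain ⟨ε, hε, hpos⟩ := (hev.and eventually_mem_nhdsWithin).exists
  have hpos : 0 < ε := hpos
  have := hmin (fun i => t i + ε * r i) hε (by
    simp only [add_smul, mul_smul, Finset.sum_add_distrib]
    rw [← Finset.smul_sum, hr, smul_zero, add_zero])
  simp only [mul_add, Finset.sum_add_distrib] at this
  have h2 : ∑ i, c i * (ε * r i) = ε * ∑ i, c i * r i := by
    rw [Finset.mul_sum]
    exact Finset.sum_congr rfl fun i _ => by ring
  rw [h2] at this
  exact nonneg_of_mul_nonneg_right (by linarith) hpos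

theorem exists_isOptimalBasis {X : Fin N → Fin n → ℤ} {c : Fin N → ℝ}
    (hc : LinearIndependent ℤ c) {z : Fin n → ℝ} (hz : z ∈ subZonotope X Finset.univ)
    (hgen : ∀ A T : Finset (Fin N), ¬ Spans X A →
      z - castVec n (∑ i ∈ T, X i) ∉
        Submodule.span ℝ ((fun i => castVec n (X i)) '' (A : Set (Fin N)))) :
    ∃ b y t, IsOptimalBasis X c z b y t := by
  classical
  let K : Set (Fin N → ℝ) := (Set.univ.pi fun _ => Set.Icc (0 : ℝ) 1) ∩
    {t | ∑ i, t i • castVec n (X i) = z}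
  have hK : IsCompact K := (isCompact_univ_pi fun _ => isCompact_Icc).inter_right
    (isClosed_eq (by fun_prop) continuous_const)
  obtain ⟨t₀, h₀, -, hz₀⟩ := hz
  obtain ⟨t, ⟨htI, htz⟩, hmin⟩ := hK.exists_isMinOn (f := fun t => ∑ i, c i * t i)
    ⟨t₀, fun i _ => h₀ i, hz₀.symm⟩ (Continuous.continuousOn (by fun_prop))
  have htI : ∀ i, t i ∈ Set.Icc (0 : ℝ) 1 := fun i => htI i trivial
  have htz : ∑ i, t i • castVec n (X i) = z := htz
  have hmin : ∀ t' : Fin N → ℝ, (∀ i, t' i ∈ Set.Icc (0 : ℝ) 1) →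
      ∑ i, t' i • castVec n (X i) = ∑ i, t i • castVec n (X i) →
      ∑ i, c i * t i ≤ ∑ i, c i * t' i := fun t' h h' =>
    hmin ⟨fun i _ => h i, h'.trans htz⟩
  let b : Finset (Fin N) := Finset.univ.filter fun i => t i ∈ Set.Ioo (0 : ℝ) 1
  have hmem : ∀ i, i ∈ b ↔ t i ∈ Set.Ioo (0 : ℝ) 1 := fun i => by simp [b]
  have hnot : ∀ i ∉ b, t i = 0 ∨ t i = 1 := by
    intro i hi
    rw [hmem, Set.mem_Ioo, not_and_or, not_lt, not_lt] at hi
    rcases hi with hi | hi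
    · exact Or.inl (le_antisymm hi (htI i).1)
    · exact Or.inr (le_antisymm (htI i).2 hi)
  have hspan : Spans X b := by
    by_contra hns
    refine hgen b (Finset.univ.filter fun i => t i = 1) hns ?_
    have : z - castVec n (∑ i with t i = 1, X i) = ∑ i ∈ b, t i • castVec n (X i) := by
      rw [← htz, map_sum, sub_eq_iff_eq_add, Finset.sum_filter, Finset.sum_filter,
        ← Finset.sum_add_distrib]
      refine Finset.sum_congr rfl fun i _ => ?_
      by_cases hi : i ∈ b
      · have hi' := (hmem i).1 hi
        simp [hi', hi'.2.ne]
      · have hi' := mt (hmem i).2 hi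
        rw [if_neg hi']
        rcases hnot i hi with h | h <;> simp [h]
    rw [this]
    exact sum_mem fun i hi => Submodule.smul_mem _ _ (Submodule.subset_span ⟨i, hi, rfl⟩)
  have hfeas : ∀ r : Fin N → ℝ, (∀ i ∉ b, r i = 0) → ∑ i, r i • castVec n (X i) = 0 →
      0 ≤ ∑ i, c i * r i := by
    intro r hr h
    refine sum_nonneg_of_isMinOn htI hmin h (fun i hi => ?_) (fun i hi => ?_)
    · rw [hr i (by simp [hmem, hi])]
    · rw [hr i (by simp [hmem, hi])]
  have hli : LinearIndepOn ℝ (fun i => castVec n (X i)) (b : Set (Fin N)) := by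
    rw [linearIndepOn_castVec_iff, linearIndepOn_finset_iff]
    intro g hg
    let r : Fin N → ℤ := fun i => if i ∈ b then g i else 0
    have hr : ∑ i, (r i : ℝ) • castVec n (X i) = 0 := by
      have := congrArg (castVec n) hg
      simp only [map_sum, map_zsmul, map_zero] at this
      simp only [r, Int.cast_smul_eq_zsmul, ite_smul, zero_smul, Finset.sum_ite_mem,
        Finset.univ_inter, this]
    have h1 := hfeas (fun i => r i) (fun i hi => by simp [r, hi]) hr
    have h2 := hfeas (fun i => -r i) (fun i hi => by simp [r, hi]) (by simp [hr])
    have h3 : ∑ i, r i • c i = 0 := by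
      simp only [zsmul_eq_mul]
      simp only [mul_neg, Finset.sum_neg_distrib] at h1 h2
      simp only [mul_comm _ (c _)]
      linarith
    intro i hi
    have := linearIndependent_iff'.1 hc _ r h3 i (Finset.mem_univ i)
    simpa [r, hi] using this
  let B : Module.Basis b ℝ (Fin n → ℝ) := Module.Basis.mk hli (by
    have : Set.range (fun i : b => castVec n (X i)) =
        (fun i => castVec n (X i)) '' (b : Set (Fin N)) := by
      ext; simp
    exact this ▸ (show ⊤ ≤ Submodule.span ℝ _ from hspan.ge))
  let y : (Fin n → ℝ) →ₗ[ℝ] ℝ := B.constr ℝ fun i => c i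
  have hy : ∀ i ∈ b, y (castVec n (X i)) = c i := fun i hi => by
    have h : B ⟨i, hi⟩ = castVec n (X i) := Module.Basis.mk_apply _ _ _
    rw [← h]
    exact B.constr_basis ℝ (fun i : b => c i) ⟨i, hi⟩
  refine ⟨b, y, t, htI, htz, hspan, hli, hy, fun i hi => (hmem i).1 hi, fun j hj => ?_⟩
  have hne := apply_castVec_ne_of_notMem hc hspan y hy hj
  have hin : castVec n (X j) ∈
      Submodule.span ℝ ((fun i => castVec n (X i)) '' (b : Set (Fin N))) := by
    rw [hspan]; trivial
  obtain ⟨a, ha⟩ := exists_sum_eq_of_mem_span_image hin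
  let r : Fin N → ℝ := fun i => (if i = j then 1 else 0) - if i ∈ b then a i else 0
  have hr : ∑ i, r i • castVec n (X i) = 0 := by
    simp [r, sub_smul, Finset.sum_ite_mem, ha]
  have hcr : ∑ i, c i * r i = c j - y (castVec n (X j)) := by
    rw [← ha]
    simp only [r, mul_sub, Finset.sum_sub_distrib, map_sum, map_smul, smul_eq_mul]
    simp only [mul_ite, mul_one, mul_zero, Finset.sum_ite_eq', Finset.mem_univ, if_true,
      Finset.sum_ite_mem, Finset.univ_inter]
    congr 1
    exact Finset.sum_congr rfl fun i hi => by rw [hy i hi, mul_comm]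
  have hrj : r j = 1 := by simp [r, hj]
  have hrn : ∀ i ∉ b, i ≠ j → r i = 0 := fun i hi hij => by simp [r, hi, hij]
  rcases hnot j hj with h | h
  · left
    have := sum_nonneg_of_isMinOn htI hmin hr (fun i hi => ?_) (fun i hi => ?_)
    · exact ⟨h, lt_of_le_of_ne (by linarith) hne⟩
    · rcases eq_or_ne i j with rfl | hij
      · simp [hrj]
      · rw [hrn i (by simp [hmem, hi]) hij]
    · rcases eq_or_ne i j with rfl | hij
      · linarith
      · rw [hrn i (by simp [hmem, hi]) hij]
  · right
    have := sum_nonneg_of_isMinOn htI hmin (r := -r) (by simp [hr]) (fun i hi => ?_)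
      (fun i hi => ?_)
    · simp only [Pi.neg_apply, mul_neg, Finset.sum_neg_distrib] at this
      exact ⟨h, lt_of_le_of_ne (by linarith) hne.symm⟩
    · rcases eq_or_ne i j with rfl | hij
      · linarith
      · simp [hrn i (by simp [hmem, hi]) hij]
    · rcases eq_or_ne i j with rfl | hij
      · simp [hrj]
      · simp [hrn i (by simp [hmem, hi]) hij]

end OptimalBasis

section Deformation

/-- The monomial of exponent `a` in the ring of generalized polynomials with real exponents. -/
noncomputable def monomialExp (a : ℝ) : AddMonoidAlgebra ℂ ℝ := AddMonoidAlgebra.single a 1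

lemma monomialExp_zero : monomialExp 0 = 1 := rfl

lemma monomialExp_add (a b : ℝ) : monomialExp (a + b) = monomialExp a * monomialExp b := by
  simp [monomialExp, AddMonoidAlgebra.single_mul_single]

lemma isUnit_monomialExp (a : ℝ) : IsUnit (monomialExp a) :=
  IsUnit.of_mul_eq_one (monomialExp (-a)) (by
    rw [← monomialExp_add, add_neg_cancel, monomialExp_zero])

/-- Evaluation of generalized polynomials at `exp θ`. -/
noncomputable def evalExp (θ : ℝ) : AddMonoidAlgebra ℂ ℝ →ₐ[ℂ] ℂ :=
  AddMonoidAlgebra.lift ℂ ℂ ℝ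
    { toFun := fun a => (Real.exp (θ * a.toAdd) : ℂ)
      map_one' := by simp
      map_mul' := fun a b => by
        rw [toAdd_mul, mul_add, Real.exp_add, Complex.ofReal_mul] }

lemma evalExp_monomialExp (θ a : ℝ) : evalExp θ (monomialExp a) = (Real.exp (θ * a) : ℂ) := by
  simp [evalExp, monomialExp, AddMonoidAlgebra.lift_single]

/-- A square matrix with unit diagonal whose other entries vanish or are monomials of negative
exponent is nonsingular. -/
lemma det_ne_zero_of_monomialExp {P : Type*} [Fintype P] [DecidableEq P]
    (A : Matrix P P (AddMonoidAlgebra ℂ ℝ)) (hd : ∀ p, A p p = 1)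
    (ho : ∀ p q, p ≠ q → A p q = 0 ∨ ∃ a < 0, A p q = monomialExp a) : A.det ≠ 0 := by
  intro h
  have hentry : Filter.Tendsto (fun θ => A.map (evalExp θ)) Filter.atTop
      (nhds (1 : Matrix P P ℂ)) := by
    refine tendsto_pi_nhds.2 fun p => tendsto_pi_nhds.2 fun q => ?_
    simp only [Matrix.map_apply]
    rcases eq_or_ne p q with rfl | hpq
    · simp only [hd, map_one, Matrix.one_apply_eq]
      exact tendsto_const_nhds
    · rw [Matrix.one_apply_ne hpq]
      rcases ho p q hpq with h0 | ⟨a, ha, h1⟩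
      · simp only [h0, map_zero]
        exact tendsto_const_nhds
      · simp only [h1, evalExp_monomialExp]
        have : Filter.Tendsto (fun θ : ℝ => Real.exp (θ * a)) Filter.atTop (nhds 0) :=
          Real.tendsto_exp_atBot.comp (Filter.tendsto_id.atTop_mul_const_of_neg ha)
        have h2 := (Complex.continuous_ofReal.tendsto 0).comp this
        rwa [Complex.ofReal_zero] at h2
  have hdet : Filter.Tendsto (fun θ => (A.map (evalExp θ)).det) Filter.atTop
      (nhds (1 : Matrix P P ℂ).det) :=
    ((continuous_id.matrix_det).tendsto (1 : Matrix P P ℂ)).comp hentry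
  have hz : (fun θ => (A.map (evalExp θ)).det) = fun _ => 0 := by
    funext θ
    have := AlgHom.map_det (evalExp θ) A
    rw [h, map_zero] at this
    exact this.symm
  rw [hz, Matrix.det_one] at hdet
  exact zero_ne_one (tendsto_nhds_unique tendsto_const_nhds hdet)

variable {n N : ℕ}

/-- The function supported on the coset of `p` modulo the lattice of `b` which is the monomial
of exponent `y (x - p)` there. -/
noncomputable def cosetMonomial (X : Fin N → Fin n → ℤ) (b : Finset (Fin N))
    (y : (Fin n → ℝ) →ₗ[ℝ] ℝ) (p x : Fin n → ℤ) : AddMonoidAlgebra ℂ ℝ :=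
  open Classical in
  if x - p ∈ Submodule.span ℤ (X '' b) then monomialExp (y (castVec n (x - p))) else 0

lemma twistedNabla_cosetMonomial {X : Fin N → Fin n → ℤ} {c : Fin N → ℝ} {b : Finset (Fin N)}
    {y : (Fin n → ℝ) →ₗ[ℝ] ℝ} (hs : Spans X b) (hy : ∀ i ∈ b, y (castVec n (X i)) = c i)
    (p : Fin n → ℤ) (A : Finset (Fin N)) (hA : ¬ Spans X (Finset.univ \ A)) :
    twistedNabla (fun i => monomialExp (c i)) X A (cosetMonomial X b y p) = 0 := by
  obtain ⟨i, hib, hiA⟩ : ∃ i ∈ b, i ∈ A := by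
    by_contra! h
    refine hA (eq_top_iff.2 ?_)
    rw [← show _ = ⊤ from hs]
    refine Submodule.span_mono (Set.image_mono fun i hi => ?_)
    simpa using h i hi
  refine twistedNabla_eq_zero_of_mem _ X hiA fun x => ?_
  have hX : X i ∈ Submodule.span ℤ (X '' b) := Submodule.subset_span ⟨i, hib, rfl⟩
  have hiff : x - X i - p ∈ Submodule.span ℤ (X '' b) ↔ x - p ∈ Submodule.span ℤ (X '' b) := by
    rw [sub_right_comm, Submodule.sub_mem_iff_left _ hX]
  by_cases hx : x - p ∈ Submodule.span ℤ (X '' b)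
  · rw [cosetMonomial, cosetMonomial, if_pos hx, if_pos (hiff.2 hx), smul_eq_mul, ← monomialExp_add, ← hy i hib, ← map_add, ← map_add]
    congr 3
    abel
  · rw [cosetMonomial, cosetMonomial, if_neg hx, if_neg (mt hiff.1 hx), smul_zero]

/-- The lattice points of the translate of the zonotope by `-v`. -/
def latticePoints (X : Fin N → Fin n → ℤ) (v : Fin n → ℝ) : Set (Fin n → ℤ) :=
  {x | castVec n x + v ∈ subZonotope X Finset.univ}

/-- The shift `v` avoids the lattice translates of the subspaces spanned by the non-spanning
sublists. -/
def IsGenericShift (X : Fin N → Fin n → ℤ) (v : Fin n → ℝ) : Prop :=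
  ∀ (x : Fin n → ℤ) (A : Finset (Fin N)), ¬ Spans X A →
    castVec n x + v ∉ Submodule.span ℝ ((fun i => castVec n (X i)) '' (A : Set (Fin N)))

/-- The submodule of relations of the deformed Dahmen–Micchelli space. -/
noncomputable def relations {R : Type*} [CommRing R] (t : Fin N → R) (X : Fin N → Fin n → ℤ) :
    Submodule R ((Fin n → ℤ) →₀ R) :=
  Submodule.span R {w | ∃ A, ¬ Spans X (Finset.univ \ A) ∧
    ∃ x, w = twistedNabla t X A (fun x => Finsupp.single x 1) x}

lemma linearCombination_eq_zero_of_mem_relations {R : Type*} [CommRing R] {t : Fin N → R}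
    {X : Fin N → Fin n → ℤ} {f : (Fin n → ℤ) → R}
    (hf : ∀ A, ¬ Spans X (Finset.univ \ A) → twistedNabla t X A f = 0)
    {w : (Fin n → ℤ) →₀ R} (hw : w ∈ relations t X) : Finsupp.linearCombination R f w = 0 := by
  have : relations t X ≤ LinearMap.ker (Finsupp.linearCombination R f) := by
    refine Submodule.span_le.2 ?_
    rintro _ ⟨A, hA, x, rfl⟩
    rw [SetLike.mem_coe, LinearMap.mem_ker, ← twistedNabla_comp_linearMap]
    simp only [Finsupp.linearCombination_single, one_smul]
    exact congrFun (hf A hA) x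
  exact this hw

/-- Modulo the relations, every point is a combination of the lattice points of a translate of
the zonotope. -/
lemma exists_sub_sum_mem_relations {R : Type*} [CommRing R] {t : Fin N → R}
    (ht : ∀ i, IsUnit (t i)) (X : Fin N → Fin n → ℤ) (v : Fin n → ℝ)
    [Fintype (latticePoints X v)] (x : Fin n → ℤ) :
    ∃ a : latticePoints X v → R,
      Finsupp.single x 1 - ∑ p, a p • Finsupp.single (p : Fin n → ℤ) (1 : R) ∈ relations t X := by
  let U : Submodule R ((Fin n → ℤ) →₀ R) := relations t X ⊔
    Submodule.span R (Set.range fun p : latticePoints X v => Finsupp.single (p : Fin n → ℤ) 1)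
  have h := eq_zero_of_vanishes_on_subZonotope t ht X Finset.univ v
    (fun x => U.mkQ (Finsupp.single x 1)) (fun A _ hA => ?_) (fun x hx => ?_)
  · have hx : Finsupp.single x 1 ∈ U := (Submodule.Quotient.mk_eq_zero U).1 (congrFun h x)
    obtain ⟨w, hw, w', hw', hadd⟩ := Submodule.mem_sup.1 hx
    obtain ⟨a, rfl⟩ := (Submodule.mem_span_range_iff_exists_fun R).1 hw'
    exact ⟨a, by rwa [← hadd, add_sub_cancel_right]⟩
  · funext x
    rw [twistedNabla_comp_linearMap]
    exact (Submodule.Quotient.mk_eq_zero U).2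
      (Submodule.mem_sup_left (Submodule.subset_span ⟨A, hA, x, rfl⟩))
  · exact (Submodule.Quotient.mk_eq_zero U).2
      (Submodule.mem_sup_right (Submodule.subset_span ⟨⟨x, hx⟩, rfl⟩))

/-- For a generic shift, there are no relations between the lattice points of the translated
zonotope in the deformation. -/
lemma eq_zero_of_sum_mem_relations {X : Fin N → Fin n → ℤ} {c : Fin N → ℝ}
    (hc : LinearIndependent ℤ c) {v : Fin n → ℝ} (hv : IsGenericShift X v)
    [Fintype (latticePoints X v)] (u : latticePoints X v → AddMonoidAlgebra ℂ ℝ)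
    (hu : ∑ p, u p • Finsupp.single (p : Fin n → ℤ) 1 ∈
      relations (fun i => monomialExp (c i)) X) : u = 0 := by
  classical
  have hex : ∀ p : latticePoints X v,
      ∃ b y τ, IsOptimalBasis X c (castVec n (p : Fin n → ℤ) + v) b y τ := by
    intro p
    refine exists_isOptimalBasis hc p.2 fun A T hA => ?_
    have := hv (p - ∑ i ∈ T, X i) A hA
    rwa [map_sub, sub_add_eq_add_sub] at this
  choose b y τ h using hex
  let φ : latticePoints X v → ℝ := fun p => ∑ i, c i * τ p i
  let A : Matrix (latticePoints X v) (latticePoints X v) (AddMonoidAlgebra ℂ ℝ) := fun p q =>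
    cosetMonomial X (b p) (y p) p q * monomialExp (φ p - φ q)
  have hdet : A.det ≠ 0 := by
    refine det_ne_zero_of_monomialExp A (fun p => ?_) fun p q hpq => ?_
    · simp [A, cosetMonomial, monomialExp_zero]
    · by_cases hm : (q : Fin n → ℤ) - p ∈ Submodule.span ℤ (X '' b p)
      · right
        refine ⟨y p (castVec n (q - p)) + (φ p - φ q), ?_, ?_⟩
        · obtain ⟨m, hm⟩ := exists_sum_eq_of_mem_span_image hm
          have hqp : castVec n (q : Fin n → ℤ) + v - (castVec n (p : Fin n → ℤ) + v) =
              castVec n (q - p) := by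
            rw [map_sub]; abel
          rcases (h p).lt_or_eq (h q).mem_Icc (h q).sum_eq m (by rw [hm, hqp]) with hlt | heq
          · rw [hqp] at hlt
            simp only [φ]
            linarith
          · exact absurd (Subtype.ext (castVec_injective n (add_right_cancel heq))) hpq.symm
        · simp only [A, cosetMonomial, if_pos hm, monomialExp_add]
      · left
        simp [A, cosetMonomial, hm]
  have hmul : A.mulVec (fun q => u q * monomialExp (φ q)) = 0 := by
    funext p
    have h0 := linearCombination_eq_zero_of_mem_relations
      (twistedNabla_cosetMonomial (h p).spans (h p).apply_eq p) hu
    simp only [map_sum, map_smul, Finsupp.linearCombination_single, smul_eq_mul, one_mul] at h0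
    have : ∀ q, A p q * (u q * monomialExp (φ q)) =
        monomialExp (φ p) * (u q * cosetMonomial X (b p) (y p) p q) := by
      intro q
      have : monomialExp (φ p) = monomialExp (φ p - φ q) * monomialExp (φ q) := by
        rw [← monomialExp_add, sub_add_cancel]
      simp only [A]
      rw [this]
      ring
    simp only [Matrix.mulVec, dotProduct, this]
    rw [← Finset.mul_sum, h0, mul_zero]
    rfl
  have hzero := Matrix.eq_zero_of_mulVec_eq_zero hdet hmul
  funext q
  exact (isUnit_monomialExp (φ q)).mul_left_eq_zero.1 (congrFun hzero q)

lemma nabla_eq_twistedNabla (X : Fin N → Fin n → ℤ) (A : Finset (Fin N))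
    (f : (Fin n → ℤ) → ℂ) : nabla X A f = twistedNabla (fun _ => (1 : ℂ)) X A f := by
  funext x
  simp [nabla, twistedNabla]

lemma mem_DMspace_iff {X : Fin N → Fin n → ℤ} {f : (Fin n → ℤ) → ℂ} :
    f ∈ DMspace X ↔ ∀ A, ¬ Spans X (Finset.univ \ A) → nabla X A f = 0 := by
  refine forall_congr' fun A => imp_congr_left ?_
  have h : (fun i (j : Fin n) => (X i j : ℝ)) = fun i => castVec n (X i) := rfl
  rw [h, Spans]
  constructor
  · intro hlt htop
    rw [htop, finrank_top, Module.finrank_fin_fun] at hlt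
    exact hlt.false
  · intro hne
    simpa using Submodule.finrank_lt hne

/-- For a generic shift, there are functions in the Dahmen–Micchelli space with arbitrary values
on the lattice points of the translated zonotope. -/
lemma exists_mem_DMspace_eq_single {X : Fin N → Fin n → ℤ} {v : Fin n → ℝ}
    (hv : IsGenericShift X v) [Fintype (latticePoints X v)] [DecidableEq (latticePoints X v)]
    (p : latticePoints X v) :
    ∃ f ∈ DMspace X, ∀ q : latticePoints X v, f q = (Pi.single p 1 : latticePoints X v → ℂ) q := by
  obtain ⟨c, hc⟩ := exists_linearIndependent_int_real N
  let t : Fin N → AddMonoidAlgebra ℂ ℝ := fun i => monomialExp (c i)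
  let E : (latticePoints X v → AddMonoidAlgebra ℂ ℝ) →ₗ[AddMonoidAlgebra ℂ ℝ]
      ((Fin n → ℤ) →₀ AddMonoidAlgebra ℂ ℝ) :=
    Fintype.linearCombination _ fun q => Finsupp.single (q : Fin n → ℤ) 1
  choose a ha using exists_sub_sum_mem_relations (t := t) (fun i => isUnit_monomialExp (c i)) X v
  have ha : ∀ x, (relations t X).mkQ (E (a x)) = (relations t X).mkQ (Finsupp.single x 1) :=
    fun x => ((Submodule.Quotient.eq _).2 (ha x)).symm
  have hE : ∀ u, (relations t X).mkQ (E u) = 0 → u = 0 := fun u hu =>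
    eq_zero_of_sum_mem_relations hc hv u ((Submodule.Quotient.mk_eq_zero _).1 hu)
  refine ⟨fun x => evalExp 0 (a x p), mem_DMspace_iff.2 fun A hA => ?_, fun q => ?_⟩
  · funext x
    have h0 : twistedNabla t X A a x = 0 := by
      refine hE _ ?_
      rw [← twistedNabla_comp_linearMap, ← twistedNabla_comp_linearMap]
      simp only [ha]
      rw [twistedNabla_comp_linearMap]
      exact (Submodule.Quotient.mk_eq_zero _).2 (Submodule.subset_span ⟨A, hA, x, rfl⟩)
    have h1 := congrArg (evalExp 0) (congrFun h0 p)
    simpa [twistedNabla, nabla, t, evalExp_monomialExp] using h1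
  · have h0 : a q - Pi.single q 1 = 0 := by
      refine hE _ ?_
      rw [map_sub, map_sub, ha]
      simp [E, Fintype.linearCombination_apply_single]
    simp only [sub_eq_zero.1 h0]
    rcases eq_or_ne q p with rfl | hqp
    · simp
    · simp [hqp, hqp.symm]

end Deformation

section Volume

variable {n N : ℕ}

lemma subZonotope_univ (X : Fin N → Fin n → ℤ) :
    subZonotope X Finset.univ = zonotope fun i (j : Fin n) => (X i j : ℝ) := by
  ext z
  simp only [subZonotope, zonotope, Finset.mem_univ, not_true_eq_false, IsEmpty.forall_iff,
    implies_true, true_and]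
  rfl

lemma isCompact_subZonotope_univ (X : Fin N → Fin n → ℤ) :
    IsCompact (subZonotope X Finset.univ) := by
  have hK : IsCompact (Set.univ.pi fun _ : Fin N => Set.Icc (0 : ℝ) 1) :=
    isCompact_univ_pi fun _ => isCompact_Icc
  have hc : Continuous fun t : Fin N → ℝ => ∑ i, t i • castVec n (X i) := by fun_prop
  convert hK.image hc using 1
  ext z
  simp only [subZonotope, Finset.mem_univ, not_true_eq_false, IsEmpty.forall_iff, implies_true,
    true_and, Set.mem_image, Set.mem_univ_pi, Set.mem_ofPred_eq]
  exact exists_congr fun t => and_congr_right fun _ => eq_comm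

lemma finite_latticePoints (X : Fin N → Fin n → ℤ) (v : Fin n → ℝ) :
    (latticePoints X v).Finite := by
  have hb := (isCompact_subZonotope_univ X).isBounded
  obtain ⟨l, hl⟩ := hb.bddBelow
  obtain ⟨u, hu⟩ := hb.bddAbove
  refine (Set.finite_Icc (fun j => ⌊l j - v j⌋) (fun j => ⌈u j - v j⌉)).subset fun x hx => ?_
  constructor <;> intro j
  · have h : l j ≤ x j + v j := hl hx j
    exact Int.floor_le_iff.2 (by linarith)
  · have h : x j + v j ≤ u j := hu hx j
    exact Int.le_ceil_iff.2 (by linarith)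

lemma ae_isGenericShift (X : Fin N → Fin n → ℤ) :
    ∀ᵐ v : Fin n → ℝ ∂volume, IsGenericShift X v := by
  refine ae_all_iff.2 fun x => ae_all_iff.2 fun A => ?_
  by_cases hA : Spans X A
  · simp [hA]
  · have h0 : volume ((Submodule.span ℝ ((fun i => castVec n (X i)) '' (A : Set (Fin N))) :
        Submodule ℝ (Fin n → ℝ)) : Set (Fin n → ℝ)) = 0 :=
      Measure.addHaar_submodule _ _ hA
    rw [← measure_preimage_add volume (castVec n x)] at h0
    filter_upwards [measure_eq_zero_iff_ae_notMem.1 h0] with v hv _ using hv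

/-- The volume of a measurable set is the average number of lattice points of its translates. -/
lemma volume_eq_lintegral_tsum_indicator {Z : Set (Fin n → ℝ)} (hZ : MeasurableSet Z) :
    volume Z = ∫⁻ v in Set.univ.pi fun _ => Set.Ico (0 : ℝ) 1,
      ∑' x : Fin n → ℤ, Z.indicator 1 (castVec n x + v) := by
  let C : Set (Fin n → ℝ) := Set.univ.pi fun _ => Set.Ico (0 : ℝ) 1
  have hC : MeasurableSet C := MeasurableSet.univ_pi fun _ => measurableSet_Ico
  let D : (Fin n → ℤ) → Set (Fin n → ℝ) := fun x => (fun v => -castVec n x + v) ⁻¹' C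
  have hmemD : ∀ x v, v ∈ D x ↔ ∀ j, ⌊v j⌋ = x j := by
    intro x v
    simp only [D, C, Set.mem_preimage, Set.mem_univ_pi, Set.mem_Ico]
    refine forall_congr' fun j => ?_
    rw [Int.floor_eq_iff]
    change (0 ≤ -(x j : ℝ) + v j ∧ -(x j : ℝ) + v j < 1) ↔ _
    constructor <;> rintro ⟨h1, h2⟩ <;> constructor <;> linarith
  have hDmeas : ∀ x, MeasurableSet (D x) := fun x => (measurable_const_add _) hC
  have hU : Z = ⋃ x, Z ∩ D x := by
    rw [← Set.inter_iUnion]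
    refine (Set.inter_eq_left.2 fun v _ => Set.mem_iUnion.2 ⟨fun j => ⌊v j⌋, ?_⟩).symm
    exact (hmemD _ _).2 fun j => rfl
  have hdisj : Pairwise (Function.onFun Disjoint fun x => Z ∩ D x) := by
    intro x x' hne
    refine Set.disjoint_left.2 fun v hv hv' => hne (funext fun j => ?_)
    rw [← (hmemD _ _).1 hv.2 j, (hmemD _ _).1 hv'.2 j]
  have hmeas : ∀ x : Fin n → ℤ,
      Measurable fun v => Z.indicator (1 : (Fin n → ℝ) → ENNReal) (castVec n x + v) :=
    fun x => (measurable_one.indicator hZ).comp (measurable_const_add _)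
  calc volume Z = ∑' x, volume (Z ∩ D x) := by
        conv_lhs => rw [hU]
        exact measure_iUnion hdisj fun x => hZ.inter (hDmeas x)
    _ = ∑' x : Fin n → ℤ, ∫⁻ v in C, Z.indicator 1 (castVec n x + v) := by
        refine tsum_congr fun x => ?_
        rw [← measure_preimage_add volume (castVec n x)]
        have h1 : (fun v => castVec n x + v) ⁻¹' (Z ∩ D x) =
            ((fun v => castVec n x + v) ⁻¹' Z) ∩ C := by
          ext v
          simp [D]
        have h2 : (fun v => Z.indicator (1 : (Fin n → ℝ) → ENNReal) (castVec n x + v)) =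
            ((fun v => castVec n x + v) ⁻¹' Z).indicator 1 := rfl
        rw [h1, h2, lintegral_indicator_one ((measurable_const_add _) hZ),
          Measure.restrict_apply ((measurable_const_add _) hZ)]
    _ = _ := (lintegral_tsum fun x => (hmeas x).aemeasurable).symm

lemma tsum_indicator_eq_card (X : Fin N → Fin n → ℤ) (v : Fin n → ℝ)
    [Fintype (latticePoints X v)] :
    ∑' x : Fin n → ℤ, (subZonotope X Finset.univ).indicator (1 : (Fin n → ℝ) → ENNReal)
      (castVec n x + v) = Fintype.card (latticePoints X v) := by
  have h : (fun x => (subZonotope X Finset.univ).indicator (1 : (Fin n → ℝ) → ENNReal)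
      (castVec n x + v)) = (latticePoints X v).indicator 1 := rfl
  rw [h, ← tsum_subtype (latticePoints X v) (1 : (Fin n → ℤ) → ENNReal), tsum_fintype]
  simp

/-- Restriction of functions in the Dahmen–Micchelli space to the lattice points of a translate
of the zonotope. -/
noncomputable def restrictLatticePoints (X : Fin N → Fin n → ℤ) (v : Fin n → ℝ) :
    DMspace X →ₗ[ℂ] (latticePoints X v → ℂ) :=
  (LinearMap.funLeft ℂ ℂ Subtype.val).comp (DMspace X).subtype

lemma restrictLatticePoints_injective (X : Fin N → Fin n → ℤ) (v : Fin n → ℝ) :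
    Function.Injective (restrictLatticePoints X v) := by
  refine (injective_iff_map_eq_zero _).2 fun f hf => Subtype.ext ?_
  refine eq_zero_of_vanishes_on_subZonotope (fun _ => (1 : ℂ)) (fun _ => isUnit_one) X
    Finset.univ v f.1 (fun A _ hA => ?_) (fun x hx => congrFun hf ⟨x, hx⟩)
  rw [← nabla_eq_twistedNabla]
  exact mem_DMspace_iff.1 f.2 A hA

lemma restrictLatticePoints_surjective {X : Fin N → Fin n → ℤ} {v : Fin n → ℝ}
    (hv : IsGenericShift X v) : Function.Surjective (restrictLatticePoints X v) := by
  classical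
  have := (finite_latticePoints X v).fintype
  rw [← LinearMap.range_eq_top, eq_top_iff, ← (Pi.basisFun ℂ (latticePoints X v)).span_eq,
    Submodule.span_le]
  rintro _ ⟨p, rfl⟩
  obtain ⟨f, hf, hfp⟩ := exists_mem_DMspace_eq_single hv p
  exact ⟨⟨f, hf⟩, by rw [Pi.basisFun_apply]; exact funext hfp⟩

end Volume

/-- The discrete Dahmen–Micchelli space `DM(X)` is finite-dimensional, of dimension the
volume of the zonotope `Z(X)`. -/
theorem stmt12 {n N : ℕ} (X : Fin N → Fin n → ℤ)
    (hspan : Submodule.span ℝ (Set.range (fun i (j : Fin n) => (X i j : ℝ))) = ⊤) :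
    FiniteDimensional ℂ (DMspace X) ∧
      (Module.finrank ℂ (DMspace X) : ℝ) =
        (volume (zonotope (fun i (j : Fin n) => (X i j : ℝ)))).toReal := by
  have hfin : FiniteDimensional ℂ (DMspace X) := by
    have := (finite_latticePoints X 0).fintype
    exact Module.Finite.of_injective _ (restrictLatticePoints_injective X 0)
  refine ⟨hfin, ?_⟩
  have hae : ∀ᵐ v : Fin n → ℝ ∂volume, ∑' x : Fin n → ℤ, (subZonotope X Finset.univ).indicator
      (1 : (Fin n → ℝ) → ENNReal) (castVec n x + v) = Module.finrank ℂ (DMspace X) := by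
    filter_upwards [ae_isGenericShift X] with v hv
    have := (finite_latticePoints X v).fintype
    rw [tsum_indicator_eq_card, (LinearEquiv.ofBijective _
      ⟨restrictLatticePoints_injective X v, restrictLatticePoints_surjective hv⟩).finrank_eq,
      Module.finrank_fintype_fun_eq_card]
  rw [← subZonotope_univ,
    volume_eq_lintegral_tsum_indicator (isCompact_subZonotope_univ X).isClosed.measurableSet,
    lintegral_congr_ae (ae_restrict_of_ae hae), setLIntegral_const, Real.volume_pi_Ico]
  simp
end

section
/- Let X be a finite totally ordered list of vectors in a real vector space. Then T_X(x,y) = Σ_B x^{i(B)} y^{e(B)}, where the sum is over all bases B extracted from X (maximal linearly independent sublists), and i(B), e(B) denote respectively the internal and external activity of B. -/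
/-- The rank of a sublist `A` of a list of vectors in a real vector space. -/
noncomputable def rk {V : Type*} [AddCommGroup V] [Module ℝ V] {ι : Type*} [Fintype ι]
    (v : ι → V) (A : Finset ι) : ℕ :=
  Module.finrank ℝ (Submodule.span ℝ (v '' ↑A))

/-- The Tutte polynomial `T_X(x,y)` of a list of vectors, as a real-valued function. -/
noncomputable def Tpoly {V : Type*} [AddCommGroup V] [Module ℝ V] {ι : Type*} [Fintype ι]
    (v : ι → V) (x y : ℝ) : ℝ :=
  ∑ A : Finset ι, (x - 1) ^ (rk v Finset.univ - rk v A) * (y - 1) ^ (A.card - rk v A)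

/-- `B` is a basis extracted from the list `v`: a linearly independent sublist spanning the
same subspace as the whole list (i.e. a maximal linearly independent sublist). -/
def IsExtractedBasis {V : Type*} [AddCommGroup V] [Module ℝ V] {N : ℕ}
    (v : Fin N → V) (B : Finset (Fin N)) : Prop :=
  LinearIndependent ℝ (fun i : {i : Fin N // i ∈ B} => v i.1) ∧
    Submodule.span ℝ (v '' ↑B) = Submodule.span ℝ (Set.range v)

/-- `v i` is externally active for the basis `B`: `i ∉ B` and `v i` is a linear combination of
the elements of `B` following it in the total order. -/
def ExtActive {V : Type*} [AddCommGroup V] [Module ℝ V] {N : ℕ}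
    (v : Fin N → V) (B : Finset (Fin N)) (i : Fin N) : Prop :=
  i ∉ B ∧ v i ∈ Submodule.span ℝ (v '' {j | j ∈ B ∧ i < j})

/-- `v i` is internally active for the basis `B`: `i ∈ B` and there is no element of the list
preceding `v i` which can replace it in `B` so as to obtain again a basis. -/
def IntActive {V : Type*} [AddCommGroup V] [Module ℝ V] {N : ℕ}
    (v : Fin N → V) (B : Finset (Fin N)) (i : Fin N) : Prop :=
  i ∈ B ∧ ¬ ∃ j : Fin N, j < i ∧ IsExtractedBasis v (insert j (B.erase i))

/-- The external activity `e(B)` of a basis `B`. -/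
noncomputable def eAct {V : Type*} [AddCommGroup V] [Module ℝ V] {N : ℕ}
    (v : Fin N → V) (B : Finset (Fin N)) : ℕ :=
  Nat.card {i : Fin N | ExtActive v B i}

/-- The internal activity `i(B)` of a basis `B`. -/
noncomputable def iAct {V : Type*} [AddCommGroup V] [Module ℝ V] {N : ℕ}
    (v : Fin N → V) (B : Finset (Fin N)) : ℕ :=
  Nat.card {i : Fin N | IntActive v B i}

open Submodule in
theorem LinearIndepOn.mem_span_image_of_forall {K V ι : Type*} [DivisionRing K] [AddCommGroup V]
    [Module K V] {v : ι → V} {B S : Set ι} (hB : LinearIndepOn K v B) {m : V}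
    (hm : m ∈ span K (v '' B)) (h : ∀ b ∈ B, b ∉ S → m ∈ span K (v '' (B \ {b}))) :
    m ∈ span K (v '' S) := by
  obtain ⟨c, hc, rfl⟩ := (Finsupp.mem_span_image_iff_linearCombination K).1 hm
  refine (Finsupp.mem_span_image_iff_linearCombination K).2 ⟨c, fun b hb => ?_, rfl⟩
  by_contra hbS
  obtain ⟨d, hd, hdc⟩ := (Finsupp.mem_span_image_iff_linearCombination K).1 (h b (hc hb) hbS)
  have hd' : d ∈ Finsupp.supported K K B := Finsupp.supported_mono Set.sdiff_subset hd
  have hcd : d - c = 0 := linearIndepOn_iff.1 hB (d - c) (sub_mem hd' hc) (by simp [hdc])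
  rw [← sub_eq_zero.1 hcd] at hb
  exact (hd hb).2 rfl

section Greedy

variable {V : Type*} [AddCommGroup V] [Module ℝ V] {ι : Type*} [Fintype ι]

open Classical in
/-- The greedy basis extracted from `v` when its indices are processed in increasing order of
`f`. -/
noncomputable def greedyBasis (v : ι → V) (f : ι → ℕ) : Finset ι :=
  {i | v i ∉ Submodule.span ℝ (v '' {j | f j < f i})}

theorem mem_greedyBasis {v : ι → V} {f : ι → ℕ} {i : ι} :
    i ∈ greedyBasis v f ↔ v i ∉ Submodule.span ℝ (v '' {j | f j < f i}) := by
  simp [greedyBasis]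

theorem mem_span_greedyBasis_le (v : ι → V) (f : ι → ℕ) (i : ι) :
    v i ∈ Submodule.span ℝ (v '' {j | j ∈ greedyBasis v f ∧ f j ≤ f i}) := by
  induction hn : f i using Nat.strong_induction_on generalizing i with
  | _ n ih =>
    subst hn
    by_cases hi : i ∈ greedyBasis v f
    · exact Submodule.subset_span ⟨i, ⟨hi, le_rfl⟩, rfl⟩
    · rw [mem_greedyBasis, not_not] at hi
      refine Submodule.span_le.2 ?_ hi
      rintro _ ⟨j, hj, rfl⟩
      refine Submodule.span_mono (Set.image_mono ?_) (ih (f j) hj j rfl)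
      exact fun k hk => ⟨hk.1, hk.2.trans (le_of_lt hj)⟩

theorem mem_span_greedyBasis_lt {v : ι → V} {f : ι → ℕ} {i : ι} (hi : i ∉ greedyBasis v f) :
    v i ∈ Submodule.span ℝ (v '' {j | j ∈ greedyBasis v f ∧ f j < f i}) := by
  rw [mem_greedyBasis, not_not] at hi
  refine Submodule.span_le.2 ?_ hi
  rintro _ ⟨j, hj, rfl⟩
  refine Submodule.span_mono (Set.image_mono ?_) (mem_span_greedyBasis_le v f j)
  exact fun k hk => ⟨hk.1, hk.2.trans_lt hj⟩

theorem linearIndepOn_greedyBasis (v : ι → V) {f : ι → ℕ} (hf : f.Injective) :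
    LinearIndepOn ℝ v (greedyBasis v f : Set ι) := by
  classical
  suffices h : ∀ s : Finset ι, s ⊆ greedyBasis v f → LinearIndepOn ℝ v (s : Set ι) from
    h _ subset_rfl
  intro s
  induction s using Finset.induction_on_max_value f with
  | empty => simp
  | insert a s has hmax ih =>
    intro hs
    rw [Finset.insert_subset_iff] at hs
    rw [Finset.coe_insert]
    refine (ih hs.2).insert fun hmem => mem_greedyBasis.1 hs.1 ?_
    refine Submodule.span_mono (Set.image_mono fun x hx => ?_) hmem
    exact lt_of_le_of_ne (hmax x hx) fun h => has (hf h ▸ hx)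

theorem eq_greedyBasis {v : ι → V} {f : ι → ℕ} {B : Finset ι}
    (hB : LinearIndepOn ℝ v (B : Set ι))
    (h : ∀ i ∉ B, v i ∈ Submodule.span ℝ (v '' {j | j ∈ B ∧ f j < f i})) :
    greedyBasis v f = B := by
  ext i
  rw [mem_greedyBasis]
  refine ⟨fun hi => ?_, fun hi hmem => ?_⟩
  · by_contra hiB
    exact hi (Submodule.span_mono (Set.image_mono fun j hj => hj.2) (h i hiB))
  · refine hB.notMem_span hi (Submodule.span_le.2 ?_ hmem)
    rintro _ ⟨j, hj, rfl⟩
    rw [Set.mem_ofPred_eq] at hj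
    by_cases hjB : j ∈ B
    · exact Submodule.subset_span ⟨j, ⟨hjB, by rintro rfl; exact hj.false⟩, rfl⟩
    · refine Submodule.span_mono (Set.image_mono fun k hk => ?_) (h j hjB)
      exact ⟨hk.1, by rintro rfl; exact (hj.trans hk.2).false⟩

end Greedy

section Activity

variable {V : Type*} [AddCommGroup V] [Module ℝ V] {N : ℕ} {v : Fin N → V}

theorem IsExtractedBasis.linearIndepOn {B : Finset (Fin N)} (hB : IsExtractedBasis v B) :
    LinearIndepOn ℝ v (B : Set (Fin N)) := hB.1

theorem IsExtractedBasis.mem_span {B : Finset (Fin N)} (hB : IsExtractedBasis v B) (i : Fin N) :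
    v i ∈ Submodule.span ℝ (v '' B) :=
  hB.2 ▸ Submodule.subset_span ⟨i, rfl⟩

theorem isExtractedBasis_iff {B : Finset (Fin N)} :
    IsExtractedBasis v B ↔
      LinearIndepOn ℝ v (B : Set (Fin N)) ∧ ∀ i, v i ∈ Submodule.span ℝ (v '' B) := by
  refine ⟨fun hB => ⟨hB.1, hB.mem_span⟩, fun ⟨h, hs⟩ => ⟨h, le_antisymm ?_ ?_⟩⟩
  · exact Submodule.span_mono (Set.image_subset_range _ _)
  · rw [Submodule.span_le]
    rintro _ ⟨i, rfl⟩
    exact hs i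

theorem isExtractedBasis_greedyBasis (v : Fin N → V) {f : Fin N → ℕ} (hf : f.Injective) :
    IsExtractedBasis v (greedyBasis v f) :=
  isExtractedBasis_iff.2 ⟨linearIndepOn_greedyBasis v hf, fun i =>
    Submodule.span_mono (Set.image_mono fun _ hj => hj.1) (mem_span_greedyBasis_le v f i)⟩

theorem IsExtractedBasis.exchange_iff {B : Finset (Fin N)} (hB : IsExtractedBasis v B)
    {i j : Fin N} (hi : i ∈ B) :
    IsExtractedBasis v (insert j (B.erase i)) ↔
      v j ∉ Submodule.span ℝ (v '' (B \ {i} : Set (Fin N))) := by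
  rw [isExtractedBasis_iff, Finset.coe_insert, Finset.coe_erase]
  constructor
  · rintro ⟨-, hs⟩ hj
    refine hB.linearIndepOn.notMem_span hi ?_
    have := hs i
    rwa [Set.image_insert_eq, Submodule.span_insert_eq_span hj] at this
  · intro hj
    refine ⟨(hB.linearIndepOn.mono Set.sdiff_subset).insert hj, fun k => ?_⟩
    have hvi : v i ∈ Submodule.span ℝ (v '' insert j (B \ {i} : Set (Fin N))) := by
      rw [Set.image_insert_eq]
      refine mem_span_insert_exchange ?_ hj
      rw [← Set.image_insert_eq, Set.insert_sdiff_singleton, Set.insert_eq_of_mem hi]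
      exact hB.mem_span j
    refine Submodule.span_le.2 ?_ (hB.mem_span k)
    rintro _ ⟨b, hb, rfl⟩
    by_cases hbi : b = i
    · exact hbi ▸ hvi
    · exact Submodule.subset_span ⟨b, Or.inr ⟨hb, hbi⟩, rfl⟩

theorem IsExtractedBasis.intActive_iff {B : Finset (Fin N)} (hB : IsExtractedBasis v B)
    {i : Fin N} :
    IntActive v B i ↔
      i ∈ B ∧ ∀ j < i, v j ∈ Submodule.span ℝ (v '' (B \ {i} : Set (Fin N))) := by
  refine and_congr_right fun hi => ?_
  push Not
  refine forall₂_congr fun j _ => ?_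
  rw [hB.exchange_iff hi, not_not]

/-- The sort key that lists the elements of `A` in decreasing order, followed by the remaining
indices in increasing order. -/
def activityKey (A : Finset (Fin N)) (i : Fin N) : ℕ :=
  if i ∈ A then N - 1 - i else N + i

theorem activityKey_injective (A : Finset (Fin N)) : (activityKey A).Injective := by
  intro i j h
  ext
  unfold activityKey at h
  split_ifs at h <;> omega

theorem activityKey_lt_iff_of_mem {A : Finset (Fin N)} {i j : Fin N} (hi : i ∈ A) :
    activityKey A j < activityKey A i ↔ j ∈ A ∧ i < j := by
  simp only [activityKey, if_pos hi, Fin.lt_def]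
  split_ifs with hj <;> simp only [hj, true_and, false_and, iff_false] <;> omega

theorem activityKey_lt_iff_of_notMem {A : Finset (Fin N)} {i j : Fin N} (hi : i ∉ A) :
    activityKey A j < activityKey A i ↔ j ∈ A ∨ j < i := by
  simp only [activityKey, if_neg hi, Fin.lt_def]
  split_ifs with hj <;> simp only [hj, true_or, false_or, iff_true] <;> omega

theorem IsExtractedBasis.greedyBasis_eq_iff {A B : Finset (Fin N)} (hB : IsExtractedBasis v B) :
    greedyBasis v (activityKey A) = B ↔
      (∀ i ∈ B, i ∉ A → IntActive v B i) ∧ ∀ i ∈ A, i ∉ B → ExtActive v B i := by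
  constructor
  · rintro rfl
    refine ⟨fun i hiB hiA => hB.intActive_iff.2 ⟨hiB, fun j hj => ?_⟩,
      fun i hiA hiB => ⟨hiB, ?_⟩⟩
    · by_cases hjB : j ∈ greedyBasis v (activityKey A)
      · exact Submodule.subset_span ⟨j, ⟨hjB, hj.ne⟩, rfl⟩
      · refine Submodule.span_mono (Set.image_mono fun k hk => ?_) (mem_span_greedyBasis_lt hjB)
        refine ⟨hk.1, ?_⟩
        rintro rfl
        exact (hk.2.trans ((activityKey_lt_iff_of_notMem hiA).2 (Or.inr hj))).false
    · refine Submodule.span_mono (Set.image_mono fun k hk => ?_) (mem_span_greedyBasis_lt hiB)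
      exact ⟨hk.1, ((activityKey_lt_iff_of_mem hiA).1 hk.2).2⟩
  · rintro ⟨hint, hext⟩
    refine eq_greedyBasis hB.linearIndepOn fun i hi => ?_
    refine hB.linearIndepOn.mem_span_image_of_forall (hB.mem_span i) fun b hb hbS => ?_
    have hbS' : ¬ activityKey A b < activityKey A i := fun h => hbS ⟨hb, h⟩
    by_cases hib : i < b
    · have hbA : b ∉ A := by
        intro hbA
        by_cases hiA : i ∈ A
        · exact hbS' ((activityKey_lt_iff_of_mem hiA).2 ⟨hbA, hib⟩)
        · exact hbS' ((activityKey_lt_iff_of_notMem hiA).2 (Or.inl hbA))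
      exact (hB.intActive_iff.1 (hint b hb hbA)).2 i hib
    · have hbi : b < i := lt_of_le_of_ne (not_lt.1 hib) (by rintro rfl; exact hi hb)
      have hiA : i ∈ A := by
        by_contra hiA
        exact hbS' ((activityKey_lt_iff_of_notMem hiA).2 (Or.inr hbi))
      refine Submodule.span_mono (Set.image_mono fun k hk => ?_) (hext i hiA hi).2
      refine ⟨hk.1, ?_⟩
      rintro rfl
      exact hib hk.2

theorem rk_eq_card {S A : Finset (Fin N)} (hS : LinearIndepOn ℝ v (S : Set (Fin N))) (hSA : S ⊆ A)
    (h : ∀ i ∈ A, v i ∈ Submodule.span ℝ (v '' S)) : rk v A = S.card := by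
  have hspan : Submodule.span ℝ (v '' A) = Submodule.span ℝ (v '' S) := by
    refine le_antisymm (Submodule.span_le.2 ?_) (Submodule.span_mono (Set.image_mono hSA))
    rintro _ ⟨i, hi, rfl⟩
    exact h i hi
  rw [rk, hspan, Set.image_eq_range]
  simpa using finrank_span_eq_card hS

theorem IsExtractedBasis.rk_univ {B : Finset (Fin N)} (hB : IsExtractedBasis v B) :
    rk v Finset.univ = B.card :=
  rk_eq_card hB.linearIndepOn (Finset.subset_univ _) fun i _ => hB.mem_span i

theorem rk_eq_card_inter_greedyBasis (v : Fin N → V) (A : Finset (Fin N)) :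
    rk v A = (greedyBasis v (activityKey A) ∩ A).card := by
  refine rk_eq_card ((linearIndepOn_greedyBasis v (activityKey_injective A)).mono ?_)
    Finset.inter_subset_right fun i hi => ?_
  · exact_mod_cast Finset.inter_subset_left
  · by_cases hiB : i ∈ greedyBasis v (activityKey A)
    · exact Submodule.subset_span ⟨i, Finset.mem_coe.2 (Finset.mem_inter.2 ⟨hiB, hi⟩), rfl⟩
    · refine Submodule.span_mono (Set.image_mono fun k hk => ?_) (mem_span_greedyBasis_lt hiB)
      exact Finset.mem_coe.2
        (Finset.mem_inter.2 ⟨hk.1, ((activityKey_lt_iff_of_mem hi).1 hk.2).1⟩)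

theorem sum_powerset_sub_one_pow_card {ι R : Type*} [CommRing R] (s : Finset ι) (a : R) :
    ∑ t ∈ s.powerset, (a - 1) ^ t.card = a ^ s.card := by
  simpa using Finset.sum_pow_mul_eq_add_pow (a - 1) 1 s

open Classical in
theorem IsExtractedBasis.sum_greedyBasis_eq {B : Finset (Fin N)} (hB : IsExtractedBasis v B)
    (x y : ℝ) :
    ∑ A with greedyBasis v (activityKey A) = B,
        (x - 1) ^ (rk v Finset.univ - rk v A) * (y - 1) ^ (A.card - rk v A) =
      x ^ iAct v B * y ^ eAct v B := by
  have hI : iAct v B = (Finset.univ.filter (IntActive v B)).card := by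
    simp [iAct, Nat.card_eq_fintype_card, Fintype.card_subtype]
  have hE : eAct v B = (Finset.univ.filter (ExtActive v B)).card := by
    simp [eAct, Nat.card_eq_fintype_card, Fintype.card_subtype]
  rw [hI, hE, ← sum_powerset_sub_one_pow_card, ← sum_powerset_sub_one_pow_card,
    Finset.sum_mul_sum, ← Finset.sum_product']
  have hInt : ∀ S ⊆ Finset.univ.filter (IntActive v B), S ⊆ B := fun S hS i hi =>
    (Finset.mem_filter.1 (hS hi)).2.1
  have hExt : ∀ T ⊆ Finset.univ.filter (ExtActive v B), ∀ i ∈ T, i ∉ B := fun T hT i hi =>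
    (Finset.mem_filter.1 (hT hi)).2.1
  refine Finset.sum_bij' (fun A _ => (B \ A, A \ B)) (fun p _ => (B \ p.1) ∪ p.2) ?_ ?_ ?_ ?_ ?_
  · intro A hA
    obtain ⟨h₁, h₂⟩ := hB.greedyBasis_eq_iff.1 (Finset.mem_filter.1 hA).2
    simp only [Finset.mem_product, Finset.mem_powerset, Finset.subset_iff, Finset.mem_sdiff,
      Finset.mem_filter, Finset.mem_univ, true_and]
    exact ⟨fun i hi => h₁ i hi.1 hi.2, fun i hi => h₂ i hi.1 hi.2⟩
  · rintro ⟨S, T⟩ hp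
    obtain ⟨hS, hT⟩ := Finset.mem_product.1 hp
    rw [Finset.mem_powerset] at hS hT
    refine Finset.mem_filter.2 ⟨Finset.mem_univ _, hB.greedyBasis_eq_iff.2 ⟨?_, ?_⟩⟩
    · intro i hi hiA
      simp only [Finset.mem_union, Finset.mem_sdiff] at hiA
      exact (Finset.mem_filter.1 (hS (by tauto))).2
    · intro i hiA hi
      simp only [Finset.mem_union, Finset.mem_sdiff] at hiA
      exact (Finset.mem_filter.1 (hT (by tauto))).2
  · intro A _
    ext i
    simp only [Finset.mem_union, Finset.mem_sdiff]
    tauto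
  · rintro ⟨S, T⟩ hp
    obtain ⟨hS, hT⟩ := Finset.mem_product.1 hp
    have h₁ := hInt S (Finset.mem_powerset.1 hS)
    have h₂ := hExt T (Finset.mem_powerset.1 hT)
    ext i <;> simp only [Finset.mem_union, Finset.mem_sdiff] <;>
      have := @h₁ i <;> have := h₂ i <;> tauto
  · intro A hA
    have hr := rk_eq_card_inter_greedyBasis v A
    rw [(Finset.mem_filter.1 hA).2] at hr
    have h₁ := Finset.card_sdiff_add_card_inter B A
    have h₂ := Finset.card_sdiff_add_card_inter A B
    rw [Finset.inter_comm] at h₂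
    rw [hB.rk_univ, hr]
    congr 2 <;> dsimp only <;> omega

end Activity

/-- Crapo's theorem: `T_X(x,y) = Σ_B x^{i(B)} y^{e(B)}`, the sum being over all bases
extracted from the (totally ordered) list `X`. -/
theorem stmt14 {V : Type*} [AddCommGroup V] [Module ℝ V] {N : ℕ}
    (v : Fin N → V) (x y : ℝ) :
    Tpoly v x y =
      ∑ᶠ B ∈ {B : Finset (Fin N) | IsExtractedBasis v B},
        x ^ iAct v B * y ^ eAct v B := by
  classical
  have hset : {B : Finset (Fin N) | IsExtractedBasis v B} =
      ((Finset.univ.filter (IsExtractedBasis v) : Finset (Finset (Fin N))) : Set _) := by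
    simp
  rw [hset, finsum_mem_coe_finset, Tpoly, ← Finset.sum_fiberwise_of_maps_to
    (g := fun A => greedyBasis v (activityKey A)) (t := Finset.univ.filter (IsExtractedBasis v))]
  · exact Finset.sum_congr rfl fun B hB => (Finset.mem_filter.1 hB).2.sum_greedyBasis_eq x y
  · exact fun A _ => Finset.mem_filter.2
      ⟨Finset.mem_univ _, isExtractedBasis_greedyBasis v (activityKey_injective A)⟩
end

section
/- Let X be a finite totally ordered list of vectors in a real vector space. Then the number nbc(X) of no-broken-circuit bases of X (bases B extracted from X with external activity e(B) = 0) equals T_X(1,0). -/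
open scoped symmDiff in
/-- Toggling an index `i` in `A`, when `v i` is spanned by the members of `A` after `i`, does not
change the span of the part of `A` in any upper set. -/
theorem span_image_symmDiff_singleton_le {V ι : Type*} [AddCommGroup V] [Module ℝ V]
    [LinearOrder ι] (v : ι → V) {A : Finset ι} {i : ι}
    (hi : v i ∈ Submodule.span ℝ (v '' {j | j ∈ A ∧ i < j})) {U : Set ι} (hU : IsUpperSet U) :
    Submodule.span ℝ (v '' {j | j ∈ A ∆ {i} ∧ j ∈ U}) ≤
      Submodule.span ℝ (v '' {j | j ∈ A ∧ j ∈ U}) := by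
  rw [Submodule.span_le]
  rintro _ ⟨j, ⟨hj, hjU⟩, rfl⟩
  by_cases hji : j = i
  · subst hji
    have hsub : {k | k ∈ A ∧ j < k} ⊆ {k | k ∈ A ∧ k ∈ U} :=
      fun k hk => ⟨hk.1, hU hk.2.le hjU⟩
    exact Submodule.span_mono (Set.image_mono hsub) hi
  · refine Submodule.subset_span ⟨j, ⟨?_, hjU⟩, rfl⟩
    simpa [Finset.mem_symmDiff, hji] using hj

open scoped symmDiff in
theorem mem_span_image_symmDiff_singleton {V ι : Type*} [AddCommGroup V] [Module ℝ V]
    [LinearOrder ι] (v : ι → V) {A : Finset ι} {i : ι}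
    (hi : v i ∈ Submodule.span ℝ (v '' {j | j ∈ A ∧ i < j})) :
    v i ∈ Submodule.span ℝ (v '' {j | j ∈ A ∆ {i} ∧ i < j}) := by
  have h : {j | j ∈ A ∆ {i} ∧ i < j} = {j | j ∈ A ∧ i < j} := by
    ext j
    refine and_congr_left fun hj => ?_
    simp [Finset.mem_symmDiff, hj.ne']
  rwa [h]

open scoped symmDiff in
theorem span_image_symmDiff_singleton {V ι : Type*} [AddCommGroup V] [Module ℝ V]
    [LinearOrder ι] (v : ι → V) {A : Finset ι} {i : ι}
    (hi : v i ∈ Submodule.span ℝ (v '' {j | j ∈ A ∧ i < j})) {U : Set ι} (hU : IsUpperSet U) :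
    Submodule.span ℝ (v '' {j | j ∈ A ∆ {i} ∧ j ∈ U}) =
      Submodule.span ℝ (v '' {j | j ∈ A ∧ j ∈ U}) := by
  refine le_antisymm (span_image_symmDiff_singleton_le v hi hU) ?_
  have h := span_image_symmDiff_singleton_le v (mem_span_image_symmDiff_singleton v hi) hU
  rwa [symmDiff_symmDiff_cancel_right] at h

/-- A family in which no member is spanned by the later ones is linearly independent. -/
theorem linearIndepOn_of_forall_notMem_span_lt {V ι : Type*} [AddCommGroup V] [Module ℝ V]
    [LinearOrder ι] (v : ι → V) (A : Finset ι)
    (h : ∀ i ∈ A, v i ∉ Submodule.span ℝ (v '' {j | j ∈ A ∧ i < j})) :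
    LinearIndepOn ℝ v (A : Set ι) := by
  induction A using Finset.induction_on_min with
  | empty => simp
  | insert a s ha ih =>
    rw [Finset.coe_insert]
    refine LinearIndepOn.insert (ih fun i hi hmem => ?_) fun hmem => ?_
    · exact h i (Finset.mem_insert_of_mem hi) (Submodule.span_mono
        (Set.image_mono (Set.ofPred_subset_ofPred.2
          fun j hj => ⟨Finset.mem_insert_of_mem hj.1, hj.2⟩)) hmem)
    · have hsub : (s : Set ι) ⊆ {j | j ∈ insert a s ∧ a < j} :=
        fun j hj => ⟨Finset.mem_insert_of_mem hj, ha j hj⟩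
      exact h a (Finset.mem_insert_self a s) (Submodule.span_mono (Set.image_mono hsub) hmem)

/-- The indices `i`, inside `A` or not, with `v i` spanned by the members of `A` after `i`. -/
noncomputable def spannedByLater {V ι : Type*} [AddCommGroup V] [Module ℝ V]
    [LinearOrder ι] [Fintype ι] (v : ι → V) (A : Finset ι) : Finset ι :=
  open Classical in {i | v i ∈ Submodule.span ℝ (v '' {j | j ∈ A ∧ i < j})}

theorem mem_spannedByLater {V ι : Type*} [AddCommGroup V] [Module ℝ V]
    [LinearOrder ι] [Fintype ι] {v : ι → V} {A : Finset ι} {i : ι} :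
    i ∈ spannedByLater v A ↔ v i ∈ Submodule.span ℝ (v '' {j | j ∈ A ∧ i < j}) := by
  simp [spannedByLater]

open scoped symmDiff in
theorem spannedByLater_symmDiff_singleton {V ι : Type*} [AddCommGroup V] [Module ℝ V]
    [LinearOrder ι] [Fintype ι] {v : ι → V} {A : Finset ι} {i : ι}
    (hi : i ∈ spannedByLater v A) : spannedByLater v (A ∆ {i}) = spannedByLater v A := by
  ext k
  have h := span_image_symmDiff_singleton v (mem_spannedByLater.1 hi) (isUpperSet_Ioi k)
  simp only [Set.mem_Ioi] at h
  rw [mem_spannedByLater, mem_spannedByLater, h]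

open scoped symmDiff in
theorem rk_symmDiff_singleton {V ι : Type*} [AddCommGroup V] [Module ℝ V]
    [LinearOrder ι] [Fintype ι] {v : ι → V} {A : Finset ι} {i : ι}
    (hi : i ∈ spannedByLater v A) : rk v (A ∆ {i}) = rk v A := by
  have h := span_image_symmDiff_singleton v (mem_spannedByLater.1 hi) isUpperSet_univ
  simp only [Set.mem_univ, and_true] at h
  exact congrArg (fun S : Submodule ℝ V => Module.finrank ℝ S) h

theorem rk_le_card {V ι : Type*} [AddCommGroup V] [Module ℝ V] [Fintype ι] (v : ι → V)
    (A : Finset ι) : rk v A ≤ A.card := by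
  classical
  rw [rk, ← Finset.coe_image]
  exact (finrank_span_finset_le_card _).trans Finset.card_image_le

open scoped symmDiff in
/-- Toggling a spanned index reverses the sign of a term of the alternating sum. -/
theorem neg_one_pow_symmDiff_singleton {V ι : Type*} [AddCommGroup V] [Module ℝ V]
    [LinearOrder ι] [Fintype ι] {v : ι → V} {A : Finset ι} {i : ι}
    (hi : i ∈ spannedByLater v A) :
    (-1 : ℝ) ^ (A.card - rk v A) + (-1) ^ ((A ∆ {i}).card - rk v (A ∆ {i})) = 0 := by
  have hA := rk_le_card v A
  have hB := rk_le_card v (A ∆ {i})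
  rw [rk_symmDiff_singleton hi] at hB ⊢
  by_cases hiA : i ∈ A
  · have h : A ∆ {i} = A.erase i := by
      ext j; by_cases hj : j = i <;> simp [Finset.mem_symmDiff, hj, hiA]
    rw [h] at hB ⊢
    have hc := Finset.card_erase_add_one hiA
    rw [show A.card - rk v A = (A.erase i).card - rk v A + 1 by omega, pow_succ]
    ring
  · have h : A ∆ {i} = insert i A := by
      ext j; by_cases hj : j = i <;> simp [Finset.mem_symmDiff, hj, hiA]
    rw [h, Finset.card_insert_of_notMem hiA, Nat.sub_add_comm hA, pow_succ]
    ring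

open scoped symmDiff in
theorem sum_spannedByLater_nonempty {V ι : Type*} [AddCommGroup V] [Module ℝ V]
    [LinearOrder ι] [Fintype ι] (v : ι → V) :
    ∑ A : Finset ι with (spannedByLater v A).Nonempty,
      (0 : ℝ) ^ (rk v Finset.univ - rk v A) * (-1) ^ (A.card - rk v A) = 0 := by
  have hmin (A : Finset ι) (hA : A ∈ Finset.univ.filter fun A => (spannedByLater v A).Nonempty) :
      (spannedByLater v A).Nonempty := (Finset.mem_filter.1 hA).2
  refine Finset.sum_involution
    (fun A hA => A ∆ {(spannedByLater v A).min' (hmin A hA)}) ?_ ?_ ?_ ?_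
  · intro A hA
    have hi := Finset.min'_mem _ (hmin A hA)
    have h := neg_one_pow_symmDiff_singleton hi
    rw [rk_symmDiff_singleton hi] at h ⊢
    rw [← mul_add, h, mul_zero]
  · intro A hA _ h
    simp at h
  · intro A hA
    simpa [spannedByLater_symmDiff_singleton (Finset.min'_mem _ (hmin A hA))] using hmin A hA
  · intro A hA
    simp [spannedByLater_symmDiff_singleton (Finset.min'_mem _ (hmin A hA))]

theorem linearIndepOn_of_spannedByLater_eq_empty {V ι : Type*} [AddCommGroup V] [Module ℝ V]
    [LinearOrder ι] [Fintype ι] {v : ι → V} {A : Finset ι} (h : spannedByLater v A = ∅) :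
    LinearIndepOn ℝ v (A : Set ι) :=
  linearIndepOn_of_forall_notMem_span_lt v A fun i _ hi =>
    Finset.notMem_empty i (h ▸ mem_spannedByLater.2 hi)

theorem rk_eq_card_of_linearIndepOn {V ι : Type*} [AddCommGroup V] [Module ℝ V] [Fintype ι]
    {v : ι → V} {A : Finset ι} (h : LinearIndepOn ℝ v (A : Set ι)) : rk v A = A.card := by
  have := finrank_span_eq_card h
  rw [← Set.image_eq_range] at this
  simpa [rk] using this

theorem rk_univ_le_iff {V ι : Type*} [AddCommGroup V] [Module ℝ V] [Fintype ι]
    (v : ι → V) (A : Finset ι) :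
    rk v Finset.univ ≤ rk v A ↔
      Submodule.span ℝ (v '' ↑A) = Submodule.span ℝ (Set.range v) := by
  have : FiniteDimensional ℝ (Submodule.span ℝ (Set.range v)) :=
    FiniteDimensional.span_of_finite ℝ (Set.finite_range v)
  rw [rk, rk, Finset.coe_univ, Set.image_univ]
  exact ⟨Submodule.eq_of_le_of_finrank_le (Submodule.span_mono (Set.image_subset_range _ _)),
    fun h => by rw [h]⟩

/-- The no-broken-circuit bases are the spanning sets without spanned indices. -/
theorem isExtractedBasis_and_eAct_eq_zero_iff {V : Type*} [AddCommGroup V] [Module ℝ V] {N : ℕ}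
    (v : Fin N → V) (B : Finset (Fin N)) :
    IsExtractedBasis v B ∧ eAct v B = 0 ↔
      spannedByLater v B = ∅ ∧ rk v Finset.univ ≤ rk v B := by
  have hact : eAct v B = 0 ↔ ∀ i, ¬ ExtActive v B i := by
    rw [eAct, Nat.card_eq_zero, or_iff_left (not_infinite_iff_finite.2 inferInstance),
      Set.isEmpty_coe_sort, Set.eq_empty_iff_forall_notMem]
    rfl
  rw [hact, rk_univ_le_iff]
  constructor
  · rintro ⟨⟨hli, hspan⟩, hB⟩
    refine ⟨Finset.eq_empty_of_forall_notMem fun i hi => ?_, hspan⟩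
    rw [mem_spannedByLater] at hi
    by_cases hiB : i ∈ B
    · have hsub : {j | j ∈ B ∧ i < j} ⊆ (B : Set (Fin N)) \ {i} :=
        fun j hj => ⟨hj.1, hj.2.ne'⟩
      exact LinearIndepOn.notMem_span (s := (B : Set (Fin N))) hli hiB
        (Submodule.span_mono (Set.image_mono hsub) hi)
    · exact hB i ⟨hiB, hi⟩
  · rintro ⟨h, hspan⟩
    exact ⟨⟨linearIndepOn_of_spannedByLater_eq_empty h, hspan⟩,
      fun i hi => Finset.notMem_empty i (h ▸ mem_spannedByLater.2 hi.2)⟩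

/-- The number of no-broken-circuit bases of `X` (bases with external activity `0`) equals
`T_X(1,0)`. -/
theorem stmt15 {V : Type*} [AddCommGroup V] [Module ℝ V] {N : ℕ}
    (v : Fin N → V) :
    (Nat.card {B : Finset (Fin N) | IsExtractedBasis v B ∧ eAct v B = 0} : ℝ) =
      Tpoly v 1 0 := by
  simp only [isExtractedBasis_and_eAct_eq_zero_iff]
  rw [Tpoly, sub_self, zero_sub,
    ← Finset.sum_filter_add_sum_filter_not _ fun A => (spannedByLater v A).Nonempty,
    sum_spannedByLater_nonempty, zero_add, Set.coe_ofPred, Nat.card_eq_fintype_card,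
    Fintype.card_subtype, ← Finset.sum_boole, Finset.sum_filter]
  refine Finset.sum_congr rfl fun A _ => ?_
  by_cases h : spannedByLater v A = ∅
  · have hc := rk_eq_card_of_linearIndepOn (linearIndepOn_of_spannedByLater_eq_empty h)
    simp [h, hc, zero_pow_eq, Nat.sub_eq_zero_iff_le]
  · simp [h]
end

section
/- Let X₁ be a finite list of vectors in ℤ^{n₁} and X₂ a finite list of vectors in ℤ^{n₂}, and let X be the list of vectors in ℤ^{n₁+n₂} = ℤ^{n₁} × ℤ^{n₂} obtained by taking each v ∈ X₁ as (v,0) together with each w ∈ X₂ as (0,w). Then M_X(x,y) = M_{X₁}(x,y) · M_{X₂}(x,y). -/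
/-- The rank of a sublist `A` of the list `X` of integer vectors. -/
noncomputable def rnk {n : ℕ} {ι : Type} [Fintype ι] (X : ι → Fin n → ℤ) (A : Finset ι) : ℕ :=
  Module.finrank ℝ (Submodule.span ℝ ((fun i (j : Fin n) => (X i j : ℝ)) '' ↑A))

/-- The multiplicity of a sublist `A`: the cardinality of the torsion subgroup of
`ℤ^n / ⟨A⟩`, i.e. the index `[Λ_A : ⟨A⟩]`. -/
noncomputable def mult {n : ℕ} {ι : Type} [Fintype ι] (X : ι → Fin n → ℤ) (A : Finset ι) : ℕ :=
  Nat.card (Submodule.torsion ℤ ((Fin n → ℤ) ⧸ Submodule.span ℤ (X '' ↑A)))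

/-- The multiplicity Tutte polynomial `M_X(x,y)`, as a real-valued function. -/
noncomputable def Mpoly {n : ℕ} {ι : Type} [Fintype ι] (X : ι → Fin n → ℤ) (x y : ℝ) : ℝ :=
  ∑ A : Finset ι, (mult X A : ℝ) * (x - 1) ^ (rnk X Finset.univ - rnk X A) *
    (y - 1) ^ (A.card - rnk X A)

/-- Concatenation of coordinate vectors, as a linear equivalence. -/
def appendLinearEquiv (R : Type*) [Semiring R] (m n : ℕ) :
    ((Fin m → R) × (Fin n → R)) ≃ₗ[R] (Fin (m + n) → R) :=
  (LinearEquiv.sumArrowLequivProdArrow (Fin m) (Fin n) R R).symm ≪≫ₗ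
    LinearEquiv.funCongrLeft R R finSumFinEquiv.symm

theorem appendLinearEquiv_apply {R : Type*} [Semiring R] {m n : ℕ}
    (v : Fin m → R) (w : Fin n → R) :
    appendLinearEquiv R m n (v, w) = Fin.append v w := by
  ext k
  induction k using Fin.addCases <;>
    simp [appendLinearEquiv, LinearEquiv.funCongrLeft_apply, LinearMap.funLeft_apply]

theorem span_append_image_disjSum {R α β : Type*} [Semiring R] {m n : ℕ}
    (f : α → Fin m → R) (g : β → Fin n → R) (A : Finset α) (B : Finset β) :
    Submodule.span R (Sum.elim (fun i => Fin.append (f i) (0 : Fin n → R))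
        (fun j => Fin.append (0 : Fin m → R) (g j)) '' ↑(A.disjSum B)) =
      ((Submodule.span R (f '' ↑A)).prod (Submodule.span R (g '' ↑B))).map
        (appendLinearEquiv R m n : _ →ₗ[R] _) := by
  rw [← LinearMap.span_inl_union_inr, Submodule.map_span]
  congr 1
  ext v
  simp [appendLinearEquiv_apply, or_and_right, exists_or]

theorem finrank_submodule_prod {K V W : Type*} [DivisionRing K] [AddCommGroup V] [Module K V]
    [AddCommGroup W] [Module K W] [FiniteDimensional K V] [FiniteDimensional K W]
    (S : Submodule K V) (T : Submodule K W) :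
    Module.finrank K (S.prod T) = Module.finrank K S + Module.finrank K T := by
  have h : S.prod T = LinearMap.range (S.subtype.prodMap T.subtype) := by
    rw [LinearMap.range_prodMap, Submodule.range_subtype, Submodule.range_subtype]
  rw [h, LinearMap.finrank_range_of_inj, Module.finrank_prod]
  exact S.injective_subtype.prodMap T.injective_subtype

theorem LinearEquiv.natCard_torsion_eq {R M N : Type*} [CommRing R]
    [AddCommGroup M] [Module R M] [AddCommGroup N] [Module R N] (e : M ≃ₗ[R] N) :
    Nat.card (Submodule.torsion R M) = Nat.card (Submodule.torsion R N) := by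
  refine Nat.card_congr (e.toEquiv.subtypeEquiv fun x => ?_)
  refine exists_congr fun a => ?_
  change (a : R) • x = 0 ↔ (a : R) • e x = 0
  rw [← e.map_smul, e.map_eq_zero_iff]

theorem Submodule.natCard_torsion_prod (R M N : Type*) [CommRing R]
    [AddCommGroup M] [Module R M] [AddCommGroup N] [Module R N] :
    Nat.card (Submodule.torsion R (M × N)) =
      Nat.card (Submodule.torsion R M) * Nat.card (Submodule.torsion R N) := by
  rw [← Nat.card_prod]
  refine Nat.card_congr ((Equiv.subtypeEquivRight fun x => ?_).trans Equiv.subtypeProdEquivProd)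
  simp only [Submodule.mem_torsion_iff, Prod.ext_iff]
  constructor
  · rintro ⟨a, h₁, h₂⟩
    exact ⟨⟨a, h₁⟩, a, h₂⟩
  · rintro ⟨⟨a, h₁⟩, b, h₂⟩
    refine ⟨a * b, ?_, ?_⟩
    · rw [Prod.smul_fst, mul_comm, mul_smul, h₁, smul_zero, Prod.fst_zero]
    · rw [Prod.smul_snd, mul_smul, h₂, smul_zero, Prod.snd_zero]

theorem rnk_append_disjSum {m n : ℕ} {α β : Type} [Fintype α] [Fintype β]
    (f : α → Fin m → ℤ) (g : β → Fin n → ℤ) (A : Finset α) (B : Finset β) :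
    rnk (Sum.elim (fun i => Fin.append (f i) (0 : Fin n → ℤ))
        (fun j => Fin.append (0 : Fin m → ℤ) (g j))) (A.disjSum B) = rnk f A + rnk g B := by
  have h : (fun i (j : Fin (m + n)) => ((Sum.elim (fun i => Fin.append (f i) (0 : Fin n → ℤ))
        (fun j => Fin.append (0 : Fin m → ℤ) (g j)) i j : ℤ) : ℝ)) =
      Sum.elim (fun i => Fin.append (fun j => (f i j : ℝ)) (0 : Fin n → ℝ))
        (fun i => Fin.append (0 : Fin m → ℝ) (fun j => (g i j : ℝ))) := by
    ext i k
    cases i <;> induction k using Fin.addCases <;> simp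
  rw [rnk, h, span_append_image_disjSum, LinearEquiv.finrank_map_eq, finrank_submodule_prod]
  rfl

theorem mult_append_disjSum {m n : ℕ} {α β : Type} [Fintype α] [Fintype β]
    (f : α → Fin m → ℤ) (g : β → Fin n → ℤ) (A : Finset α) (B : Finset β) :
    mult (Sum.elim (fun i => Fin.append (f i) (0 : Fin n → ℤ))
        (fun j => Fin.append (0 : Fin m → ℤ) (g j))) (A.disjSum B) = mult f A * mult g B := by
  rw [mult, span_append_image_disjSum, mult, mult, ← Submodule.natCard_torsion_prod]
  set S := Submodule.span ℤ (f '' ↑A)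
  set T := Submodule.span ℤ (g '' ↑B)
  have hker : LinearMap.ker (S.mkQ.prodMap T.mkQ) = S.prod T := by
    rw [LinearMap.ker_prodMap, Submodule.ker_mkQ, Submodule.ker_mkQ]
  have hsurj : Function.Surjective (S.mkQ.prodMap T.mkQ) :=
    S.mkQ_surjective.prodMap T.mkQ_surjective
  exact ((Submodule.Quotient.equiv _ _ (appendLinearEquiv ℤ m n) rfl).symm ≪≫ₗ
    Submodule.quotEquivOfEq _ _ hker.symm ≪≫ₗ
    LinearMap.quotKerEquivOfSurjective _ hsurj).natCard_torsion_eq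

theorem rnk_mono {n : ℕ} {ι : Type} [Fintype ι] (X : ι → Fin n → ℤ) {A B : Finset ι}
    (h : A ⊆ B) : rnk X A ≤ rnk X B :=
  Submodule.finrank_mono (Submodule.span_mono (Set.image_mono (Finset.coe_subset.2 h)))

theorem rnk_le_card {n : ℕ} {ι : Type} [Fintype ι] (X : ι → Fin n → ℤ) (A : Finset ι) :
    rnk X A ≤ A.card := by
  classical
  rw [rnk, ← Finset.coe_image]
  exact (finrank_span_finset_le_card _).trans Finset.card_image_le

/-- If `X` is the list in `ℤ^{n₁+n₂}` obtained from lists `X₁` in `ℤ^{n₁}` and `X₂` in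
`ℤ^{n₂}` by taking each `v ∈ X₁` as `(v,0)` together with each `w ∈ X₂` as `(0,w)`, then
`M_X(x,y) = M_{X₁}(x,y) · M_{X₂}(x,y)`. -/
theorem stmt16 {n₁ n₂ N₁ N₂ : ℕ} (X₁ : Fin N₁ → Fin n₁ → ℤ) (X₂ : Fin N₂ → Fin n₂ → ℤ)
    (x y : ℝ) :
    Mpoly (Sum.elim
        (fun i => Fin.append (X₁ i) (0 : Fin n₂ → ℤ))
        (fun j => Fin.append (0 : Fin n₁ → ℤ) (X₂ j))) x y =
      Mpoly X₁ x y * Mpoly X₂ x y := by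
  unfold Mpoly
  rw [Finset.sum_mul_sum, ← Finset.sum_product', Finset.univ_product_univ,
    ← Finset.sumEquiv.symm.toEquiv.sum_comp]
  refine Finset.sum_congr rfl fun ⟨A, B⟩ _ => ?_
  have hA := rnk_mono X₁ A.subset_univ
  have hB := rnk_mono X₂ B.subset_univ
  have hA' := rnk_le_card X₁ A
  have hB' := rnk_le_card X₂ B
  rw [show Finset.sumEquiv.symm.toEquiv (A, B) = A.disjSum B from rfl,
    ← Finset.univ_disjSum_univ, mult_append_disjSum, rnk_append_disjSum, rnk_append_disjSum,
    Finset.card_disjSum, ← tsub_add_tsub_comm hA hB, ← tsub_add_tsub_comm hA' hB',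
    pow_add, pow_add]
  push_cast
  ring
end
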